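/- arXiv:0802.0890 — 3 statements merged into one kernel-verified Lean document; each statement's English description precedes it below -/
import Mathlib

section
/- Let 0 < α ≤ 1/2, let f ∈ 𝒜_α be outer with ‖f‖_{𝒜_α} ≤ 1, let 1 < ρ ≤ 2, let Γ be a union of component arcs of 𝕋\E_f, and let γ = (a,b) be a component arc of 𝕋\E_f of arclength < 1/2, with d(z) ≤ 1/2 for z ∈ Δ_γ². Then ∫_{Δ_γ²²} |f(z)|^{2ρ} a_γ(z)² dA(z) ≤ C_ρ ∫_{Δ_γ} |f'(z)|² dA(z) + C · A(Δ_γ), where A(Δ_γ) is the normalized area of Δ_γ, C_ρ > 0 depends only on ρ and α, and C > 0 is a constant independent of γ and Γ. -/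
open Complex MeasureTheory Set Metric Filter
open scoped ENNReal Classical

noncomputable section

/-- The open unit disc in `ℂ`. -/
def uDisc : Set ℂ := Metric.ball 0 1

/-- The unit circle in `ℂ`. -/
def uCircle : Set ℂ := Metric.sphere (0 : ℂ) 1

/-- `f` is analytic on the open unit disc and continuous on the closed unit disc. -/
def IsDiscReg (f : ℂ → ℂ) : Prop :=
  DifferentiableOn ℂ f uDisc ∧ ContinuousOn f (Metric.closedBall 0 1)

/-- The little-o Lipschitz condition of order `α` on the closed unit disc:
`|f z - f w| = o(|z-w|^α)` as `|z - w| → 0`. -/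
def LittleLip (α : ℝ) (f : ℂ → ℂ) : Prop :=
  ∀ ε > 0, ∃ δ > 0, ∀ z ∈ Metric.closedBall (0 : ℂ) 1, ∀ w ∈ Metric.closedBall (0 : ℂ) 1,
    ‖z - w‖ < δ → ‖f z - f w‖ ≤ ε * ‖z - w‖ ^ α

/-- Membership in `lip_α`. -/
def MemLip (α : ℝ) (f : ℂ → ℂ) : Prop := IsDiscReg f ∧ LittleLip α f

/-- The Dirichlet integral `D(f) = ∫_𝔻 |f'|² dA` with respect to the normalized
area measure `dA = (1/π)·(Lebesgue)`. -/
def dirInt (f : ℂ → ℂ) : ℝ := (1 / Real.pi) * ∫ z in uDisc, ‖deriv f z‖ ^ 2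

/-- Membership in the Dirichlet space `𝒟`. -/
def MemDir (f : ℂ → ℂ) : Prop :=
  DifferentiableOn ℂ f uDisc ∧ IntegrableOn (fun z => ‖deriv f z‖ ^ 2) uDisc

/-- Sup norm over the unit disc. -/
def supNorm (f : ℂ → ℂ) : ℝ := sSup ((fun z => ‖f z‖) '' uDisc)

/-- The `lip_α` norm `‖f‖_α = ‖f‖_∞ + sup_{z∈𝔻} (1-|z|)^{1-α}|f'(z)|`. -/
def lipNorm (α : ℝ) (f : ℂ → ℂ) : ℝ :=
  supNorm f + sSup ((fun z => (1 - ‖z‖) ^ (1 - α) * ‖deriv f z‖) '' uDisc)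

/-- The `𝒜_α` norm `‖f‖_{𝒜_α} = ‖f‖_α + D(f)^{1/2}`. -/
def ANorm (α : ℝ) (f : ℂ → ℂ) : ℝ := lipNorm α f + Real.sqrt (dirInt f)

/-- Membership in `𝒜_α = 𝒟 ∩ lip_α`. -/
def MemA (α : ℝ) (f : ℂ → ℂ) : Prop := MemDir f ∧ MemLip α f

/-- A closed ideal of the Banach algebra `𝒜_α`, encoded as a set of functions `ℂ → ℂ`
(two functions agreeing on the closed disc represent the same element of `𝒜_α`). -/
structure IsClosedIdeal (α : ℝ) (J : Set (ℂ → ℂ)) : Prop where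
  mem_A : ∀ f ∈ J, MemA α f
  zero_mem : (0 : ℂ → ℂ) ∈ J
  add_mem : ∀ f ∈ J, ∀ g ∈ J, f + g ∈ J
  smul_mem : ∀ (c : ℂ), ∀ f ∈ J, c • f ∈ J
  mul_mem : ∀ f ∈ J, ∀ g : ℂ → ℂ, MemA α g → f * g ∈ J
  ext_mem : ∀ f ∈ J, ∀ g : ℂ → ℂ, MemA α g →
    (∀ z ∈ Metric.closedBall (0 : ℂ) 1, g z = f z) → g ∈ J
  closed : ∀ (F : ℕ → ℂ → ℂ) (f : ℂ → ℂ), (∀ n, F n ∈ J) → MemA α f →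
    Tendsto (fun n => ANorm α (F n - f)) atTop (nhds 0) → f ∈ J

/-- The boundary zero set `E_f = {ξ ∈ 𝕋 : f ξ = 0}`. -/
def bZeros (f : ℂ → ℂ) : Set ℂ := {ξ | ξ ∈ uCircle ∧ f ξ = 0}

/-- An inner function: bounded analytic on `𝔻` with radial limits of modulus `1`
at almost every point of `𝕋`. -/
def IsInner (U : ℂ → ℂ) : Prop :=
  DifferentiableOn ℂ U uDisc ∧ (∀ z ∈ uDisc, ‖U z‖ ≤ 1) ∧
    ∀ᵐ θ : ℝ, Tendsto (fun r : ℝ => ‖U ((r : ℂ) * Complex.exp ((θ : ℂ) * Complex.I))‖)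
      (nhdsWithin 1 (Set.Iio 1)) (nhds 1)

/-- The Schwarz/Herglotz kernel `(e^{iθ}+z)/(e^{iθ}-z)`. -/
def circleKernel (z : ℂ) (θ : ℝ) : ℂ :=
  (Complex.exp ((θ : ℂ) * Complex.I) + z) / (Complex.exp ((θ : ℂ) * Complex.I) - z)

/-- `f` is an outer function. -/
def IsOuter (f : ℂ → ℂ) : Prop :=
  IsDiscReg f ∧ (∃ z ∈ uDisc, f z ≠ 0) ∧
    ∀ z ∈ uDisc, f z = Complex.exp ((1 / (2 * (Real.pi : ℂ))) *
      ∫ θ in (0:ℝ)..(2 * Real.pi),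
        circleKernel z θ * (Real.log ‖f (Complex.exp ((θ : ℂ) * Complex.I))‖ : ℂ))

/-- The outer power `f^ρ`, the outer function with boundary modulus `|f|^ρ`. -/
def outerPow (f : ℂ → ℂ) (ρ : ℝ) (z : ℂ) : ℂ :=
  Complex.exp (((ρ : ℂ) / (2 * (Real.pi : ℂ))) *
    ∫ θ in (0:ℝ)..(2 * Real.pi),
      circleKernel z θ * (Real.log ‖f (Complex.exp ((θ : ℂ) * Complex.I))‖ : ℂ))

/-- The set of angles in `[0, 2π)` whose corresponding point of the circle lies in `A`. -/
def angSet (A : Set ℂ) : Set ℝ :=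
  {θ | θ ∈ Set.Ico (0 : ℝ) (2 * Real.pi) ∧ Complex.exp ((θ : ℂ) * Complex.I) ∈ A}

/-- The outer factor `f_Γ` associated with a boundary set `Γ ⊆ 𝕋`. -/
def outerPart (f : ℂ → ℂ) (Γ : Set ℂ) (z : ℂ) : ℂ :=
  Complex.exp ((1 / (2 * (Real.pi : ℂ))) *
    ∫ θ in angSet Γ, circleKernel z θ * (Real.log ‖f (Complex.exp ((θ : ℂ) * Complex.I))‖ : ℂ))

/-- `𝕋 \ E_f`, the set of boundary points where `f` does not vanish. -/
def offZeros (f : ℂ → ℂ) : Set ℂ := {ξ | ξ ∈ uCircle ∧ f ξ ≠ 0}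

/-- `γ` is a component arc (connected component) of `𝕋 \ E_f`. -/
def IsCompArc (f : ℂ → ℂ) (γ : Set ℂ) : Prop :=
  ∃ x ∈ offZeros f, γ = connectedComponentIn (offZeros f) x

/-- `Γ` is a union of component arcs of `𝕋 \ E_f`. -/
def IsArcUnion (f : ℂ → ℂ) (Γ : Set ℂ) : Prop :=
  Γ ⊆ offZeros f ∧ ∀ x ∈ Γ, connectedComponentIn (offZeros f) x ⊆ Γ

/-- The sector `Δ_γ = {z ∈ 𝔻 : z/|z| ∈ γ}`. -/
def discSector (γ : Set ℂ) : Set ℂ := {z | z ∈ uDisc ∧ ((‖z‖ : ℂ))⁻¹ * z ∈ γ}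

/-- Lower integral of `g` over `S` with respect to the normalized area measure
`dA = (1/π)·(Lebesgue)`. -/
def nlint (S : Set ℂ) (g : ℂ → ℝ) : ℝ≥0∞ :=
  ENNReal.ofReal (1 / Real.pi) * ∫⁻ z in S, ENNReal.ofReal (g z)

/-- `d(z) = min(|z-a|, |z-b|)`, distance to the endpoints of the arc `γ = (a,b)`. -/
def dd (a b z : ℂ) : ℝ := min ‖z - a‖ ‖z - b‖

/-- `Λ_γ`: equals `Γ` if `γ ⊄ Γ`, and `𝕋 \ Γ` if `γ ⊆ Γ`. -/
def lamSet (Γ γ : Set ℂ) : Set ℂ := if γ ⊆ Γ then uCircle \ Γ else Γ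

/-- The function `a_γ(z) = (1/2π)∫_{Λ_γ} (−log|f(e^{iθ})|)/|e^{iθ}−z|² dθ`. -/
def aFun (f : ℂ → ℂ) (Γ γ : Set ℂ) (z : ℂ) : ℝ :=
  (1 / (2 * Real.pi)) * ∫ θ in angSet (lamSet Γ γ),
    (-(Real.log ‖f (Complex.exp ((θ : ℂ) * Complex.I))‖)) /
      ‖Complex.exp ((θ : ℂ) * Complex.I) - z‖ ^ 2

/-- `Δ_γ¹ = {z ∈ Δ_γ : d(z) < 2(1−|z|)}`. -/
def sector1 (a b : ℂ) (γ : Set ℂ) : Set ℂ :=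
  {z | z ∈ discSector γ ∧ dd a b z < 2 * (1 - ‖z‖)}

/-- `Δ_γ² = {z ∈ Δ_γ : d(z) ≥ 2(1−|z|)}`. -/
def sector2 (a b : ℂ) (γ : Set ℂ) : Set ℂ :=
  {z | z ∈ discSector γ ∧ 2 * (1 - ‖z‖) ≤ dd a b z}

/-- `Δ_γ²¹ = {z ∈ Δ_γ² : a_γ(z) ≤ 8|log d(z)|/d(z)}`. -/
def sector21 (f : ℂ → ℂ) (Γ γ : Set ℂ) (a b : ℂ) : Set ℂ :=
  {z | z ∈ sector2 a b γ ∧ aFun f Γ γ z ≤ 8 * |Real.log (dd a b z)| / dd a b z}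

/-- `Δ_γ²² = {z ∈ Δ_γ² : 8|log d(z)|/d(z) < a_γ(z) < 8|log d(z)|/(1−|z|)}`. -/
def sector22 (f : ℂ → ℂ) (Γ γ : Set ℂ) (a b : ℂ) : Set ℂ :=
  {z | z ∈ sector2 a b γ ∧ 8 * |Real.log (dd a b z)| / dd a b z < aFun f Γ γ z ∧
    aFun f Γ γ z < 8 * |Real.log (dd a b z)| / (1 - ‖z‖)}

/-- `Δ_γ²³ = {z ∈ Δ_γ² : a_γ(z) ≥ 8|log d(z)|/(1−|z|)}`. -/
def sector23 (f : ℂ → ℂ) (Γ γ : Set ℂ) (a b : ℂ) : Set ℂ :=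
  {z | z ∈ sector2 a b γ ∧ 8 * |Real.log (dd a b z)| / (1 - ‖z‖) ≤ aFun f Γ γ z}

/-- `μ_z = 1 − 8|log d(z)|/a_γ(z)`. -/
def muOf (f : ℂ → ℂ) (Γ γ : Set ℂ) (a b : ℂ) (z : ℂ) : ℝ :=
  1 - 8 * |Real.log (dd a b z)| / aFun f Γ γ z

/-- The tail union `Γ_m = ⋃_{p ≥ m} γ_p`. -/
def tailUnion (γ : ℕ → Set ℂ) (m : ℕ) : Set ℂ := ⋃ p ∈ Set.Ici m, γ p

end

theorem norm_le_one_of_ANorm_le_one {α : ℝ} {f : ℂ → ℂ} (hf : IsDiscReg f)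
    (h : ANorm α f ≤ 1) {z : ℂ} (hz : z ∈ closedBall (0 : ℂ) 1) : ‖f z‖ ≤ 1 := by
  have hcl : closure (ball (0 : ℂ) 1) = closedBall 0 1 := closure_ball _ one_ne_zero
  have hsup : supNorm f ≤ 1 := by
    have h1 : 0 ≤ sSup ((fun z => (1 - ‖z‖) ^ (1 - α) * ‖deriv f z‖) '' uDisc) := by
      apply Real.sSup_nonneg
      rintro _ ⟨z, hz, rfl⟩
      have : ‖z‖ < 1 := by simpa [uDisc] using hz
      have : 0 ≤ 1 - ‖z‖ := by linarith
      positivity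
    have h2 := Real.sqrt_nonneg (dirInt f)
    unfold ANorm lipNorm at h
    linarith
  have hbdd : BddAbove ((fun z => ‖f z‖) '' uDisc) :=
    ((isCompact_closedBall (0 : ℂ) 1).bddAbove_image hf.2.norm).mono
      (image_mono ball_subset_closedBall)
  refine le_on_closure (s := ball (0 : ℂ) 1) (f := fun z => ‖f z‖) (g := fun _ => 1)
    (fun x hx => ?_) (by rw [hcl]; exact hf.2.norm) continuousOn_const (by rwa [hcl])
  exact (le_csSup hbdd (mem_image_of_mem _ hx)).trans hsup

theorem exp_mul_I_sub_ne_zero {w : ℂ} (hw : w ∈ uDisc) (θ : ℝ) :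
    Complex.exp (θ * Complex.I) - w ≠ 0 := by
  intro h
  have h1 : ‖Complex.exp (θ * Complex.I)‖ = 1 := Complex.norm_exp_ofReal_mul_I θ
  rw [sub_eq_zero.mp h] at h1
  have : ‖w‖ < 1 := by simpa [uDisc] using hw
  linarith

theorem exp_mul_I_add_ne_zero {w : ℂ} (hw : w ∈ uDisc) (θ : ℝ) :
    Complex.exp (θ * Complex.I) + w ≠ 0 := by
  have := exp_mul_I_sub_ne_zero (w := -w) (by simpa [uDisc] using hw) θ
  simpa using this

theorem continuous_circleKernel {w : ℂ} (hw : w ∈ uDisc) : Continuous (circleKernel w) := by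
  unfold circleKernel
  exact Continuous.div (by fun_prop) (by fun_prop) (exp_mul_I_sub_ne_zero hw)

theorem IsOuter.intervalIntegrable_log {f : ℂ → ℂ} (hf : IsOuter f) {a : ℂ} (ha : a ∈ bZeros f) :
    IntervalIntegrable (fun θ : ℝ => Real.log ‖f (Complex.exp (θ * Complex.I))‖) volume
      0 (2 * Real.pi) := by
  by_contra hint
  have hone : ∀ w ∈ uDisc, f w = 1 := by
    intro w hw
    rw [hf.2.2 w hw, intervalIntegral.integral_undef, mul_zero, Complex.exp_zero]
    intro hk
    apply hint
    have hinv : Continuous fun θ => (circleKernel w θ)⁻¹ :=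
      (continuous_circleKernel hw).inv₀ fun θ =>
        div_ne_zero (exp_mul_I_add_ne_zero hw θ) (exp_mul_I_sub_ne_zero hw θ)
    have hmul := hk.continuousOn_mul hinv.continuousOn
    have : IntervalIntegrable (fun θ : ℝ => ((circleKernel w θ)⁻¹ * (circleKernel w θ *
        (Real.log ‖f (Complex.exp (θ * Complex.I))‖ : ℂ))).re) volume 0 (2 * Real.pi) :=
      ⟨hmul.1.re, hmul.2.re⟩
    refine this.congr_ae (Eventually.of_forall fun θ => ?_)
    have h0 : circleKernel w θ ≠ 0 :=
      div_ne_zero (exp_mul_I_add_ne_zero hw θ) (exp_mul_I_sub_ne_zero hw θ)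
    simp only
    rw [inv_mul_cancel_left₀ h0]
    simp
  have hcl : closure (ball (0 : ℂ) 1) = closedBall 0 1 := closure_ball _ one_ne_zero
  have hacl : a ∈ closure (ball (0 : ℂ) 1) := by
    rw [hcl]; exact sphere_subset_closedBall ha.1
  have h1 : f a = 1 :=
    Set.EqOn.of_subset_closure (s := ball (0 : ℂ) 1) (t := closedBall 0 1) (g := fun _ => 1) hone
      hf.1.2 continuousOn_const ball_subset_closedBall hcl.ge (hcl ▸ hacl)
  rw [ha.2] at h1
  exact zero_ne_one h1

theorem re_circleKernel {w : ℂ} (θ : ℝ) :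
    (circleKernel w θ).re = (1 - ‖w‖ ^ 2) / ‖Complex.exp (θ * Complex.I) - w‖ ^ 2 := by
  have h1 : ‖Complex.exp (θ * Complex.I)‖ ^ 2 = 1 := by
    rw [Complex.norm_exp_ofReal_mul_I]; norm_num
  unfold circleKernel
  rw [← Complex.normSq_eq_norm_sq, ← Complex.normSq_eq_norm_sq] at *
  rw [← h1, Complex.div_re, ← add_div]
  simp [Complex.normSq_apply]
  ring

theorem IsOuter.norm_eq {f : ℂ → ℂ} (hf : IsOuter f)
    (hint : IntervalIntegrable (fun θ : ℝ => Real.log ‖f (Complex.exp (θ * Complex.I))‖) volume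
      0 (2 * Real.pi)) {w : ℂ} (hw : w ∈ uDisc) :
    ‖f w‖ = Real.exp (-((1 / (2 * Real.pi)) * ∫ θ in Ico 0 (2 * Real.pi),
      (1 - ‖w‖ ^ 2) / ‖Complex.exp (θ * Complex.I) - w‖ ^ 2 *
        -Real.log ‖f (Complex.exp (θ * Complex.I))‖)) := by
  have hi : IntervalIntegrable (fun θ : ℝ => circleKernel w θ *
      (Real.log ‖f (Complex.exp (θ * Complex.I))‖ : ℂ)) volume 0 (2 * Real.pi) := by
    refine IntervalIntegrable.continuousOn_mul ?_ (continuous_circleKernel hw).continuousOn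
    exact ⟨hint.1.ofReal, hint.2.ofReal⟩
  have hre : (∫ θ in (0:ℝ)..(2 * Real.pi), circleKernel w θ *
      (Real.log ‖f (Complex.exp (θ * Complex.I))‖ : ℂ)).re = ∫ θ in (0:ℝ)..(2 * Real.pi),
      (1 - ‖w‖ ^ 2) / ‖Complex.exp (θ * Complex.I) - w‖ ^ 2 *
        Real.log ‖f (Complex.exp (θ * Complex.I))‖ := by
    have := Complex.reCLM.intervalIntegral_comp_comm hi
    simp only [Complex.reCLM_apply] at this
    rw [← this]
    refine intervalIntegral.integral_congr fun θ _ => ?_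
    simp only [Complex.re_mul_ofReal, re_circleKernel]
  rw [hf.2.2 w hw, Complex.norm_exp]
  congr 1
  have : (1 / (2 * (Real.pi : ℂ))) = ((1 / (2 * Real.pi) : ℝ) : ℂ) := by push_cast; rfl
  rw [this, Complex.re_ofReal_mul, hre]
  simp only [mul_neg, integral_neg, neg_neg]
  rw [intervalIntegral.integral_of_le (by positivity), integral_Ico_eq_integral_Ioc]

theorem isOpen_preimage_component {f : ℂ → ℂ} (hf : IsDiscReg f) {γ : Set ℂ}
    (hγ : IsCompArc f γ) : IsOpen {t : ℝ | Complex.exp (t * Complex.I) ∈ γ} := by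
  obtain ⟨x, -, rfl⟩ := hγ
  have hmem (t : ℝ) : Complex.exp (t * Complex.I) ∈ uCircle := by
    simp [uCircle, Complex.norm_exp_ofReal_mul_I]
  have hcont : Continuous fun t : ℝ => f (Complex.exp (t * Complex.I)) :=
    hf.2.comp_continuous (by fun_prop) fun t => sphere_subset_closedBall (hmem t)
  have hopen : IsOpen {t : ℝ | f (Complex.exp (t * Complex.I)) ≠ 0} :=
    isOpen_ne.preimage hcont
  rw [Metric.isOpen_iff]
  intro t ht
  have htF : Complex.exp (t * Complex.I) ∈ offZeros f := connectedComponentIn_subset _ _ ht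
  obtain ⟨ε, hε, hball⟩ := Metric.isOpen_iff.mp hopen t htF.2
  refine ⟨ε, hε, fun s hs => ?_⟩
  have hpre : IsPreconnected ((fun t : ℝ => Complex.exp (t * Complex.I)) '' ball t ε) :=
    (convex_ball t ε).isPreconnected.image _ (by fun_prop)
  have hsub := hpre.subset_connectedComponentIn (F := offZeros f)
    (mem_image_of_mem _ (mem_ball_self hε)) (by
      rintro _ ⟨u, hu, rfl⟩
      exact ⟨hmem u, hball hu⟩)
  rw [mem_ofPred_eq, connectedComponentIn_eq ht]
  exact hsub (mem_image_of_mem _ hs)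

theorem norm_exp_sub_sq (t φ r : ℝ) :
    ‖Complex.exp (t * Complex.I) - r * Complex.exp (φ * Complex.I)‖ ^ 2 =
      1 + r ^ 2 - 2 * r * Real.cos (t - φ) := by
  rw [← Complex.normSq_eq_norm_sq, Complex.normSq_apply, Real.cos_sub]
  simp only [Complex.sub_re, Complex.sub_im, Complex.re_ofReal_mul, Complex.im_ofReal_mul,
    Complex.exp_ofReal_mul_I_re, Complex.exp_ofReal_mul_I_im]
  nlinarith [Real.sin_sq_add_cos_sq t, Real.sin_sq_add_cos_sq φ]

theorem dd_le_norm_sub {f : ℂ → ℂ} (hf : IsDiscReg f) {γ : Set ℂ} (hγ : IsCompArc f γ)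
    {a b : ℂ} (hcl : closure γ = insert a (insert b γ)) {z : ℂ} (hz : z ∈ discSector γ)
    {ξ : ℂ} (hξ : ξ ∈ uCircle) (hξγ : ξ ∉ γ) : dd a b z ≤ ‖ξ - z‖ := by
  by_contra! hlt
  have hζ := hz.2
  set ζ : ℂ := (‖z‖ : ℂ)⁻¹ * z with hζdef
  have hζ1 : ‖ζ‖ = 1 := by
    obtain ⟨x, -, rfl⟩ := hγ
    have := (connectedComponentIn_subset _ _ hζ).1
    simpa [uCircle] using this
  have hz0 : z ≠ 0 := by
    rintro rfl
    simp [hζdef] at hζ1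
  have hr : (0 : ℝ) < ‖z‖ := norm_pos_iff.mpr hz0
  have hzr : z = (‖z‖ : ℝ) * ζ := by
    rw [hζdef, mul_inv_cancel_left₀]
    exact_mod_cast hr.ne'
  have hξ1 : ‖ξ‖ = 1 := by simpa [uCircle] using hξ
  have hζ0 : ζ ≠ 0 := by
    intro h; simp [h] at hζ1
  have hφ : ζ = Complex.exp (Complex.arg ζ * Complex.I) := by
    have := Complex.norm_mul_exp_arg_mul_I ζ
    rw [hζ1] at this
    simpa using this.symm
  set φ := Complex.arg ζ
  set β := Complex.arg (ξ / ζ) with hβ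
  have hψ : ξ = Complex.exp ((φ + β : ℝ) * Complex.I) := by
    have := Complex.norm_mul_exp_arg_mul_I (ξ / ζ)
    rw [norm_div, hζ1, hξ1, div_one, Complex.ofReal_one, one_mul, ← hβ] at this
    rw [Complex.ofReal_add, add_mul, Complex.exp_add, this, ← hφ, mul_div_cancel₀ _ hζ0]
  have hβπ : |β| ≤ Real.pi := Complex.abs_arg_le_pi _
  have hdist : ∀ t ∈ uIcc φ (φ + β), ‖Complex.exp (t * Complex.I) - z‖ ≤ ‖ξ - z‖ := by
    intro t ht
    have htβ : |t - φ| ≤ |β| := by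
      have := abs_sub_left_of_mem_uIcc ht
      simpa using this
    have hcos : Real.cos β ≤ Real.cos (t - φ) := by
      rw [← Real.cos_abs β, ← Real.cos_abs (t - φ)]
      exact Real.cos_le_cos_of_nonneg_of_le_pi (abs_nonneg _) hβπ htβ
    have e1 := norm_exp_sub_sq t φ ‖z‖
    have e2 := norm_exp_sub_sq (φ + β) φ ‖z‖
    rw [← hφ, ← hzr] at e1 e2
    rw [← hψ, add_sub_cancel_left] at e2
    refine (pow_le_pow_iff_left₀ (norm_nonneg _) (norm_nonneg _) two_ne_zero).mp ?_
    rw [e1, e2]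
    nlinarith
  have hsub : uIcc φ (φ + β) ⊆ {t : ℝ | Complex.exp (t * Complex.I) ∈ γ} := by
    refine isPreconnected_uIcc.subset_of_closure_inter_subset (isOpen_preimage_component hf hγ)
      ⟨φ, left_mem_uIcc, ?_⟩ ?_
    · rw [mem_ofPred_eq, ← hφ]; exact hζ
    · rintro t ⟨htc, ht⟩
      have hcont : Continuous fun t : ℝ => Complex.exp (t * Complex.I) := by fun_prop
      have h1 : Complex.exp (t * Complex.I) ∈ closure γ := by
        have := hcont.closure_preimage_subset γ htc
        exact this
      have h2 := (hdist t ht).trans_lt hlt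
      rw [hcl] at h1
      rcases h1 with h1 | h1 | h1
      · rw [h1, norm_sub_rev] at h2
        exact absurd (min_le_left _ _) h2.not_ge
      · rw [h1, norm_sub_rev] at h2
        exact absurd (min_le_right _ _) h2.not_ge
      · exact h1
  apply hξγ
  rw [hψ]
  exact hsub right_mem_uIcc

theorem not_mem_of_mem_lamSet {f : ℂ → ℂ} {Γ γ : Set ℂ} (hΓ : IsArcUnion f Γ)
    (hγ : IsCompArc f γ) {ξ : ℂ} (hξ : ξ ∈ lamSet Γ γ) : ξ ∉ γ := by
  unfold lamSet at hξ
  split_ifs at hξ with h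
  · exact fun hx => hξ.2 (h hx)
  · intro hx
    apply h
    obtain ⟨x, -, rfl⟩ := hγ
    rw [connectedComponentIn_eq hx]
    exact hΓ.2 ξ hξ
theorem lamSet_subset_uCircle {f : ℂ → ℂ} {Γ γ : Set ℂ} (hΓ : IsArcUnion f Γ) :
    lamSet Γ γ ⊆ uCircle := by
  unfold lamSet
  split_ifs
  · exact sdiff_subset
  · exact fun x hx => (hΓ.1 hx).1

theorem continuous_inv_norm_exp_sub_sq {w : ℂ} (hw : w ∈ uDisc) :
    Continuous fun θ : ℝ => (‖Complex.exp (θ * Complex.I) - w‖ ^ 2)⁻¹ :=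
  Continuous.inv₀ (by fun_prop) fun θ =>
    pow_ne_zero 2 (norm_ne_zero_iff.mpr (exp_mul_I_sub_ne_zero hw θ))

theorem ae_restrict_angSet {f : ℂ → ℂ} (hf : IsDiscReg f) {Γ γ : Set ℂ} (hΓ : IsArcUnion f Γ)
    (hγ : IsCompArc f γ) {a b : ℂ} (hcl : closure γ = insert a (insert b γ)) {z : ℂ}
    (hz : z ∈ discSector γ) :
    ∀ᵐ θ : ℝ ∂(volume.restrict (angSet (lamSet Γ γ))),
      dd a b z ≤ ‖Complex.exp (θ * Complex.I) - z‖ := by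
  have hmeas : MeasurableSet {θ : ℝ | dd a b z ≤ ‖Complex.exp (θ * Complex.I) - z‖} :=
    measurableSet_le measurable_const (by fun_prop)
  refine ae_restrict_of_ae_restrict_of_subset (t := {θ : ℝ | dd a b z ≤
    ‖Complex.exp (θ * Complex.I) - z‖}) (fun θ hθ => ?_) (ae_restrict_mem hmeas)
  exact dd_le_norm_sub hf hγ hcl hz (lamSet_subset_uCircle hΓ hθ.2)
    (not_mem_of_mem_lamSet hΓ hγ hθ.2)

theorem angSet_subset (S : Set ℂ) : angSet S ⊆ Ico 0 (2 * Real.pi) := fun _ h => h.1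

theorem integrableOn_div_norm_sq {L : ℝ → ℝ} (hL : IntegrableOn L (Ico 0 (2 * Real.pi))) {w : ℂ}
    (hw : w ∈ uDisc) :
    IntegrableOn (fun θ => L θ / ‖Complex.exp (θ * Complex.I) - w‖ ^ 2)
      (Ico 0 (2 * Real.pi)) := by
  have h := (hL.congr_set_ae Ico_ae_eq_Icc.symm).mul_continuousOn
    (continuous_inv_norm_exp_sub_sq hw).continuousOn isCompact_Icc
  exact (h.mono_set Ico_subset_Icc_self)

theorem aFun_le {f : ℂ → ℂ} (hf : IsDiscReg f) (hf1 : ∀ z ∈ closedBall (0 : ℂ) 1, ‖f z‖ ≤ 1)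
    (hint : IntegrableOn (fun θ : ℝ => -Real.log ‖f (Complex.exp (θ * Complex.I))‖)
      (Ico 0 (2 * Real.pi))) {Γ γ : Set ℂ} (hΓ : IsArcUnion f Γ)
    (hγ : IsCompArc f γ) {a b : ℂ} (hcl : closure γ = insert a (insert b γ)) {z : ℂ}
    (hz : z ∈ discSector γ) (hd : 0 < dd a b z) :
    aFun f Γ γ z ≤ ((1 / (2 * Real.pi)) * ∫ θ in Ico 0 (2 * Real.pi),
      -Real.log ‖f (Complex.exp (θ * Complex.I))‖) / dd a b z ^ 2 := by
  have hL0 : ∀ θ : ℝ, 0 ≤ -Real.log ‖f (Complex.exp (θ * Complex.I))‖ := fun θ =>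
    neg_nonneg.mpr (Real.log_nonpos (norm_nonneg _) (hf1 _ (by
      simp [Complex.norm_exp_ofReal_mul_I])))
  unfold aFun
  rw [mul_div_assoc, ← integral_div]
  refine mul_le_mul_of_nonneg_left ?_ (by positivity)
  calc _ ≤ ∫ θ in angSet (lamSet Γ γ),
        -Real.log ‖f (Complex.exp (θ * Complex.I))‖ / dd a b z ^ 2 := by
        refine integral_mono_ae
          ((integrableOn_div_norm_sq hint hz.1).mono_set (angSet_subset _))
          ((hint.mono_set (angSet_subset _)).div_const _) ?_
        filter_upwards [ae_restrict_angSet hf hΓ hγ hcl hz] with θ hθ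
        have := hL0 θ
        gcongr
    _ ≤ _ := by
        refine setIntegral_mono_set (hint.div_const _) (Eventually.of_forall fun θ => ?_)
          (angSet_subset _).eventuallyLE
        exact div_nonneg (hL0 θ) (by positivity)

theorem norm_le_exp_aFun {f : ℂ → ℂ} (hf : IsOuter f)
    (hf1 : ∀ z ∈ closedBall (0 : ℂ) 1, ‖f z‖ ≤ 1)
    (hlog : IntervalIntegrable (fun θ : ℝ => Real.log ‖f (Complex.exp (θ * Complex.I))‖) volume
      0 (2 * Real.pi)) {Γ γ : Set ℂ} (hΓ : IsArcUnion f Γ)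
    (hγ : IsCompArc f γ) {a b : ℂ} (hcl : closure γ = insert a (insert b γ)) {z w : ℂ}
    (hz : z ∈ discSector γ) (hw : w ∈ uDisc) (hzw : ‖z - w‖ ≤ dd a b z) :
    ‖f w‖ ≤ Real.exp (-((1 - ‖w‖) / 4 * aFun f Γ γ z)) := by
  have hL0 : ∀ θ : ℝ, 0 ≤ -Real.log ‖f (Complex.exp (θ * Complex.I))‖ := fun θ =>
    neg_nonneg.mpr (Real.log_nonpos (norm_nonneg _) (hf1 _ (by
      simp [Complex.norm_exp_ofReal_mul_I])))
  have hint : IntegrableOn (fun θ : ℝ => -Real.log ‖f (Complex.exp (θ * Complex.I))‖)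
      (Ico 0 (2 * Real.pi)) := by
    exact (IntegrableOn.neg hlog.1).congr_set_ae Ico_ae_eq_Ioc
  have hw1 : ‖w‖ < 1 := by simpa [uDisc] using hw
  have hw0 := norm_nonneg w
  have hintw : IntegrableOn (fun θ : ℝ => (1 - ‖w‖ ^ 2) / ‖Complex.exp (θ * Complex.I) - w‖ ^ 2 *
      -Real.log ‖f (Complex.exp (θ * Complex.I))‖) (Ico 0 (2 * Real.pi)) := by
    refine ((integrableOn_div_norm_sq hint hw).const_mul (1 - ‖w‖ ^ 2)).congr
      (Eventually.of_forall fun θ => ?_)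
    simp only
    ring
  rw [hf.norm_eq hlog hw, Real.exp_le_exp, neg_le_neg_iff]
  unfold aFun
  rw [mul_left_comm, ← integral_const_mul]
  refine mul_le_mul_of_nonneg_left ?_ (by positivity)
  calc _ ≤ ∫ θ in angSet (lamSet Γ γ), (1 - ‖w‖ ^ 2) / ‖Complex.exp (θ * Complex.I) - w‖ ^ 2 *
        -Real.log ‖f (Complex.exp (θ * Complex.I))‖ := by
        refine integral_mono_ae
          (((integrableOn_div_norm_sq hint hz.1).mono_set (angSet_subset _)).const_mul _)
          (hintw.mono_set (angSet_subset _)) ?_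
        filter_upwards [ae_restrict_angSet hf.1 hΓ hγ hcl hz] with θ hθ
        have hez : 0 < ‖Complex.exp (θ * Complex.I) - z‖ :=
          norm_pos_iff.mpr (exp_mul_I_sub_ne_zero hz.1 θ)
        have hew : 0 < ‖Complex.exp (θ * Complex.I) - w‖ :=
          norm_pos_iff.mpr (exp_mul_I_sub_ne_zero hw θ)
        have htri : ‖Complex.exp (θ * Complex.I) - w‖ ≤
            2 * ‖Complex.exp (θ * Complex.I) - z‖ := by
          have := norm_sub_le_norm_sub_add_norm_sub (Complex.exp (θ * Complex.I)) z w
          linarith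
        have hker : (1 - ‖w‖) / 4 / ‖Complex.exp (θ * Complex.I) - z‖ ^ 2 ≤
            (1 - ‖w‖ ^ 2) / ‖Complex.exp (θ * Complex.I) - w‖ ^ 2 := by
          rw [div_div]
          refine div_le_div₀ (by nlinarith) (by nlinarith) (by positivity) ?_
          nlinarith
        calc _ = (1 - ‖w‖) / 4 / ‖Complex.exp (θ * Complex.I) - z‖ ^ 2 *
              -Real.log ‖f (Complex.exp (θ * Complex.I))‖ := by ring
          _ ≤ _ := mul_le_mul_of_nonneg_right hker (hL0 θ)
    _ ≤ _ := by
        refine setIntegral_mono_set hintw (Eventually.of_forall fun θ => ?_)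
          (angSet_subset _).eventuallyLE
        exact mul_nonneg (div_nonneg (by nlinarith) (by positivity)) (hL0 θ)

theorem sq_integral_le {h : ℝ → ℝ} {u v : ℝ} (huv : u ≤ v) (hh : ContinuousOn h (Icc u v)) :
    (∫ r in u..v, h r) ^ 2 ≤ (v - u) * ∫ r in u..v, h r ^ 2 := by
  rcases huv.eq_or_lt with rfl | hlt
  · simp
  rw [← uIcc_of_le huv] at hh
  have hi : IntervalIntegrable h volume u v := hh.intervalIntegrable
  have hi2 : IntervalIntegrable (fun r => h r ^ 2) volume u v := (hh.pow 2).intervalIntegrable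
  set A := ∫ r in u..v, h r with hA
  have hpos : 0 < v - u := sub_pos.mpr hlt
  set c := A / (v - u) with hc
  have h0 : 0 ≤ ∫ r in u..v, (h r - c) ^ 2 :=
    intervalIntegral.integral_nonneg huv fun _ _ => sq_nonneg _
  have h1 : ∫ r in u..v, (h r - c) ^ 2 = (∫ r in u..v, h r ^ 2) - 2 * c * A + c ^ 2 * (v - u) := by
    have : (fun r => (h r - c) ^ 2) = fun r => h r ^ 2 - 2 * c * h r + c ^ 2 := by
      ext r; ring
    rw [this, intervalIntegral.integral_add (hi2.sub (hi.const_mul _)) intervalIntegrable_const,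
      intervalIntegral.integral_sub hi2 (hi.const_mul _), intervalIntegral.integral_const_mul,
      intervalIntegral.integral_const, smul_eq_mul, ← hA]
    ring
  rw [h1] at h0
  have h2 : c * (v - u) = A := div_mul_cancel₀ _ hpos.ne'
  have h3 : c * A ≤ ∫ r in u..v, h r ^ 2 := by
    have : c ^ 2 * (v - u) = c * A := by rw [pow_two, mul_assoc, h2]
    linarith
  calc A ^ 2 = (v - u) * (c * A) := by rw [← mul_assoc, mul_comm (v - u), h2, pow_two]
    _ ≤ _ := mul_le_mul_of_nonneg_left h3 hpos.le

theorem norm_sub_sq_le_integral {f : ℂ → ℂ} (hf : DifferentiableOn ℂ f uDisc) {ζ : ℂ}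
    (hζ : ‖ζ‖ = 1) {u v : ℝ} (hu : 0 ≤ u) (huv : u ≤ v) (hv : v < 1) :
    ContinuousOn (fun r : ℝ => ‖deriv f (r * ζ)‖) (Icc u v) ∧
    ‖f (v * ζ) - f (u * ζ)‖ ^ 2 ≤ (v - u) * ∫ r in u..v, ‖deriv f (r * ζ)‖ ^ 2 := by
  have hopen : IsOpen uDisc := isOpen_ball
  have hmem : ∀ r ∈ Icc u v, (r : ℂ) * ζ ∈ uDisc := by
    intro r hr
    have : |r| < 1 := by rw [abs_of_nonneg (hu.trans hr.1)]; exact hr.2.trans_lt hv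
    simpa [uDisc, hζ] using this
  have hder : ContinuousOn (fun r : ℝ => deriv f (r * ζ)) (Icc u v) :=
    (hf.deriv hopen).continuousOn.comp (by fun_prop) hmem
  refine ⟨hder.norm, ?_⟩
  have hcont : ContinuousOn (fun r : ℝ => deriv f (r * ζ) * ζ) (uIcc u v) := by
    rw [uIcc_of_le huv]; exact hder.mul continuousOn_const
  have hftc : ∫ r in u..v, deriv f (r * ζ) * ζ = f (v * ζ) - f (u * ζ) := by
    refine intervalIntegral.integral_eq_sub_of_hasDerivAt (f := fun r : ℝ => f (r * ζ))
      (fun r hr => ?_) hcont.intervalIntegrable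
    rw [uIcc_of_le huv] at hr
    have h1 : HasDerivAt f (deriv f (r * ζ)) (r * ζ) :=
      (hf.differentiableAt (hopen.mem_nhds (hmem r hr))).hasDerivAt
    have h2 : HasDerivAt (fun r : ℝ => (r : ℂ) * ζ) ζ r := by
      simpa using (Complex.ofRealCLM.hasDerivAt (x := r)).mul_const ζ
    exact h1.comp r h2
  refine le_trans ?_ (sq_integral_le huv hder.norm)
  rw [← hftc]
  gcongr
  refine (intervalIntegral.norm_integral_le_integral_norm huv).trans_eq ?_
  simp [hζ]

/-- The energy of `f` along the radius from modulus `1/2` to `z`, weighted by the inverse distance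
to the circle. -/
noncomputable def radialEnergy (f : ℂ → ℂ) (z : ℂ) : ℝ≥0∞ :=
  ∫⁻ r in Ioc (1 / 2 : ℝ) ‖z‖,
    ENNReal.ofReal (1 / (1 - r)) * ENNReal.ofReal (‖deriv f (r * ((‖z‖ : ℂ)⁻¹ * z))‖ ^ 2)

theorem ofReal_div_le_radialEnergy {f : ℂ → ℂ} (hf : DifferentiableOn ℂ f uDisc) {z : ℂ}
    (hz0 : z ≠ 0) (hz : z ∈ uDisc) {δ : ℝ} (hδ : δ ≤ 1 / 2) (hzδ : 1 - ‖z‖ ≤ δ) :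
    ENNReal.ofReal (‖f z - f ((1 - δ : ℝ) * ((‖z‖ : ℂ)⁻¹ * z))‖ ^ 2 / δ ^ 2) ≤
      radialEnergy f z := by
  have hr : (0 : ℝ) < ‖z‖ := norm_pos_iff.mpr hz0
  have hz1 : ‖z‖ < 1 := by simpa [uDisc] using hz
  have hδ0 : 0 < δ := by linarith
  unfold radialEnergy
  set ζ : ℂ := (‖z‖ : ℂ)⁻¹ * z with hζ
  have hζ1 : ‖ζ‖ = 1 := by
    rw [hζ, norm_mul, norm_inv, Complex.norm_real, norm_norm, inv_mul_cancel₀ hr.ne']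
  have hzζ : z = (‖z‖ : ℝ) * ζ := by
    rw [hζ, mul_inv_cancel_left₀]
    exact_mod_cast hr.ne'
  obtain ⟨hcont, hle⟩ := norm_sub_sq_le_integral hf hζ1 (u := 1 - δ) (v := ‖z‖) (by linarith)
    (by linarith) hz1
  rw [← hzζ] at hle
  have huv : 1 - δ ≤ ‖z‖ := by linarith
  have hint : IntegrableOn (fun r : ℝ => 1 / δ * ‖deriv f (r * ζ)‖ ^ 2) (Ioc (1 - δ) ‖z‖) :=
    (((hcont.pow 2).const_smul (1 / δ)).integrableOn_Icc).mono_set Ioc_subset_Icc_self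
  have hreal : ‖f z - f ((1 - δ : ℝ) * ζ)‖ ^ 2 / δ ^ 2 ≤
      ∫ r in Ioc (1 - δ) ‖z‖, 1 / δ * ‖deriv f (r * ζ)‖ ^ 2 := by
    rw [integral_const_mul, ← intervalIntegral.integral_of_le huv, div_le_iff₀ (by positivity)]
    have hI : 0 ≤ ∫ r in (1 - δ)..‖z‖, ‖deriv f (r * ζ)‖ ^ 2 :=
      intervalIntegral.integral_nonneg huv fun _ _ => sq_nonneg _
    refine hle.trans ?_
    have : 1 / δ * (∫ r in (1 - δ)..‖z‖, ‖deriv f (r * ζ)‖ ^ 2) * δ ^ 2 =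
        δ * ∫ r in (1 - δ)..‖z‖, ‖deriv f (r * ζ)‖ ^ 2 := by
      generalize (∫ r in (1 - δ)..‖z‖, ‖deriv f (r * ζ)‖ ^ 2) = I
      field_simp
    rw [this]
    exact mul_le_mul_of_nonneg_right (by linarith) hI
  refine (ENNReal.ofReal_le_ofReal hreal).trans ?_
  rw [ofReal_integral_eq_lintegral_ofReal hint (Eventually.of_forall fun r => by positivity)]
  calc _ ≤ ∫⁻ r in Ioc (1 - δ) ‖z‖,
        ENNReal.ofReal (1 / (1 - r)) * ENNReal.ofReal (‖deriv f (r * ζ)‖ ^ 2) := by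
        refine setLIntegral_mono' measurableSet_Ioc fun r hr => ?_
        have h1 : 0 < 1 - r := by linarith [hr.2]
        have h2 : 1 - r ≤ δ := by linarith [hr.1]
        rw [← ENNReal.ofReal_mul (by positivity)]
        refine ENNReal.ofReal_le_ofReal ?_
        gcongr
    _ ≤ _ := lintegral_mono_set (Ioc_subset_Ioc_left (by linarith))

theorem measurableSet_of_closure_eq {γ : Set ℂ} {a b : ℂ}
    (hcl : closure γ = insert a (insert b γ)) : MeasurableSet γ := by
  have h : γ = closure γ \ ({a, b} \ γ) := by
    ext x
    rw [hcl]
    simp only [Set.mem_sdiff, mem_insert_iff, mem_singleton_iff]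
    tauto
  rw [h]
  exact isClosed_closure.measurableSet.diff ((toFinite {a, b}).subset sdiff_subset).measurableSet

theorem measurableSet_discSector {γ : Set ℂ} (hγ : MeasurableSet γ) :
    MeasurableSet (discSector γ) :=
  measurableSet_ball.inter
    ((show Measurable fun z : ℂ => ((‖z‖ : ℂ))⁻¹ * z by fun_prop) hγ)

theorem inv_norm_mul_polar {r : ℝ} (hr : 0 < r) (θ : ℝ) :
    ‖(r : ℂ) * Complex.exp (θ * Complex.I)‖ = r ∧
    ((‖(r : ℂ) * Complex.exp (θ * Complex.I)‖ : ℂ))⁻¹ * (r * Complex.exp (θ * Complex.I)) =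
      Complex.exp (θ * Complex.I) := by
  have h : ‖(r : ℂ) * Complex.exp (θ * Complex.I)‖ = r := by
    rw [norm_mul, Complex.norm_exp_ofReal_mul_I, mul_one, Complex.norm_real, Real.norm_eq_abs,
      abs_of_pos hr]
  refine ⟨h, ?_⟩
  rw [h, inv_mul_cancel_left₀]
  exact_mod_cast hr.ne'

theorem lintegral_discSector {γ : Set ℂ} (hγ : MeasurableSet γ) {H : ℂ → ℝ≥0∞}
    (hH : Measurable H) :
    ∫⁻ z in discSector γ, H z =
      ∫⁻ θ in Ioo (-Real.pi) Real.pi ∩ {θ : ℝ | Complex.exp (θ * Complex.I) ∈ γ},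
        ∫⁻ r in Ioo (0 : ℝ) 1, ENNReal.ofReal r * H (r * Complex.exp (θ * Complex.I)) := by
  have hθ : MeasurableSet {θ : ℝ | Complex.exp (θ * Complex.I) ∈ γ} :=
    (show Measurable fun θ : ℝ => Complex.exp (θ * Complex.I) by fun_prop) hγ
  have hF : Measurable fun p : ℝ × ℝ =>
      ENNReal.ofReal p.1 * H (p.1 * Complex.exp (p.2 * Complex.I)) := by fun_prop
  have hset : MeasurableSet (Ioo (0 : ℝ) 1 ×ˢ
      (Ioo (-Real.pi) Real.pi ∩ {θ : ℝ | Complex.exp (θ * Complex.I) ∈ γ})) :=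
    measurableSet_Ioo.prod (measurableSet_Ioo.inter hθ)
  rw [← lintegral_indicator (measurableSet_discSector hγ), ← Complex.lintegral_comp_polarCoord_symm,
    ← lintegral_indicator _root_.polarCoord.open_target.measurableSet]
  calc _ = ∫⁻ p : ℝ × ℝ, (Ioo (0 : ℝ) 1 ×ˢ
        (Ioo (-Real.pi) Real.pi ∩ {θ : ℝ | Complex.exp (θ * Complex.I) ∈ γ})).indicator
          (fun p => ENNReal.ofReal p.1 * H (p.1 * Complex.exp (p.2 * Complex.I))) p := by
        refine lintegral_congr fun p => ?_
        obtain ⟨r, θ⟩ := p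
        have hsymm : Complex.polarCoord.symm (r, θ) = r * Complex.exp (θ * Complex.I) := by
          rw [Complex.polarCoord_symm_apply, Complex.exp_mul_I]
          push_cast; rfl
        by_cases hp : (r, θ) ∈ _root_.polarCoord.target
        · rw [indicator_of_mem hp, hsymm, smul_eq_mul]
          rw [_root_.polarCoord_target] at hp
          obtain ⟨hr, hθ'⟩ := hp
          obtain ⟨h1, h2⟩ := inv_norm_mul_polar (show 0 < r from hr) θ
          have hiff : (r : ℂ) * Complex.exp (θ * Complex.I) ∈ discSector γ ↔ (r, θ) ∈
              Ioo (0 : ℝ) 1 ×ˢ (Ioo (-Real.pi) Real.pi ∩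
                {θ : ℝ | Complex.exp (θ * Complex.I) ∈ γ}) := by
            unfold discSector uDisc
            rw [mem_ofPred_eq, h2, mem_ball_zero_iff, h1]
            exact ⟨fun h => ⟨⟨hr, h.1⟩, hθ', h.2⟩, fun h => ⟨h.1.2, h.2.2⟩⟩
          by_cases hm : (r : ℂ) * Complex.exp (θ * Complex.I) ∈ discSector γ
          · rw [indicator_of_mem hm, indicator_of_mem (hiff.mp hm)]
          · rw [indicator_of_notMem hm, indicator_of_notMem (mt hiff.mpr hm), mul_zero]
        · rw [indicator_of_notMem hp, indicator_of_notMem]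
          rintro ⟨h1, h2⟩
          apply hp
          rw [_root_.polarCoord_target]
          exact ⟨h1.1, h2.1⟩
    _ = _ := by
        rw [lintegral_indicator hset, Measure.volume_eq_prod, ← Measure.prod_restrict,
          lintegral_prod_symm _ hF.aemeasurable]

theorem measurable_radialEnergy (f : ℂ → ℂ) : Measurable (radialEnergy f) := by
  have hd : Measurable (deriv f) := measurable_deriv f
  have hF : Measurable fun p : ℂ × ℝ =>
      {p : ℂ × ℝ | 1 / 2 < p.2 ∧ p.2 ≤ ‖p.1‖}.indicator (fun p => ENNReal.ofReal (1 / (1 - p.2)) *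
        ENNReal.ofReal (‖deriv f (p.2 * ((‖p.1‖ : ℂ)⁻¹ * p.1))‖ ^ 2)) p := by
    refine Measurable.indicator (by fun_prop) ?_
    exact (measurableSet_lt measurable_const measurable_snd).inter
      (measurableSet_le measurable_snd (by fun_prop))
  have heq : radialEnergy f = fun z => ∫⁻ r, {p : ℂ × ℝ | 1 / 2 < p.2 ∧ p.2 ≤ ‖p.1‖}.indicator
      (fun p => ENNReal.ofReal (1 / (1 - p.2)) *
        ENNReal.ofReal (‖deriv f (p.2 * ((‖p.1‖ : ℂ)⁻¹ * p.1))‖ ^ 2)) (z, r) := by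
    ext z
    rw [radialEnergy, ← lintegral_indicator measurableSet_Ioc]
    rfl
  rw [heq]
  exact hF.lintegral_prod_right'

theorem lintegral_mul_weighted_primitive_le {g : ℝ → ℝ≥0∞} (hg : Measurable g) :
    ∫⁻ s in Ioo (0 : ℝ) 1, ENNReal.ofReal s *
        ∫⁻ r in Ioc (1 / 2 : ℝ) s, ENNReal.ofReal (1 / (1 - r)) * g r ≤
      2 * ∫⁻ r in Ioo (0 : ℝ) 1, ENNReal.ofReal r * g r := by
  have hF : Measurable fun p : ℝ × ℝ => {p : ℝ × ℝ | 1 / 2 < p.2 ∧ p.2 ≤ p.1}.indicator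
      (fun p => ENNReal.ofReal (1 / (1 - p.2)) * g p.2) p := by
    refine Measurable.indicator (by fun_prop) ?_
    exact (measurableSet_lt measurable_const measurable_snd).inter
      (measurableSet_le measurable_snd measurable_fst)
  calc _ ≤ ∫⁻ s in Ioo (0 : ℝ) 1, ∫⁻ r, {p : ℝ × ℝ | 1 / 2 < p.2 ∧ p.2 ≤ p.1}.indicator
        (fun p => ENNReal.ofReal (1 / (1 - p.2)) * g p.2) (s, r) := by
        refine setLIntegral_mono' measurableSet_Ioo fun s hs => ?_
        rw [← lintegral_indicator measurableSet_Ioc]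
        refine (mul_le_mul_left (ENNReal.ofReal_le_one.mpr hs.2.le) _).trans_eq ?_
        rw [one_mul]
        rfl
    _ = ∫⁻ r, ∫⁻ s in Ioo (0 : ℝ) 1, {p : ℝ × ℝ | 1 / 2 < p.2 ∧ p.2 ≤ p.1}.indicator
        (fun p => ENNReal.ofReal (1 / (1 - p.2)) * g p.2) (s, r) :=
        lintegral_lintegral_swap hF.aemeasurable
    _ ≤ ∫⁻ r, (Ioo (0 : ℝ) 1).indicator (fun r => 2 * (ENNReal.ofReal r * g r)) r := by
        refine lintegral_mono fun r => ?_
        by_cases hr : 1 / 2 < r ∧ r < 1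
        · rw [indicator_of_mem (show r ∈ Ioo (0 : ℝ) 1 from ⟨by linarith [hr.1], hr.2⟩)]
          calc _ ≤ ∫⁻ s, (Ico r 1).indicator
                (fun _ => ENNReal.ofReal (1 / (1 - r)) * g r) s := by
                rw [← lintegral_indicator measurableSet_Ioo]
                refine lintegral_mono fun s => ?_
                refine indicator_apply_le' (fun hs => ?_) (fun _ => zero_le)
                refine indicator_apply_le' (fun h => ?_) (fun _ => zero_le)
                rw [indicator_of_mem (show s ∈ Ico r 1 from ⟨h.2, hs.2⟩)]
            _ = g r := by
                rw [lintegral_indicator_const measurableSet_Ico, Real.volume_Ico, mul_right_comm,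
                  ← ENNReal.ofReal_mul (by have := hr.2; exact (div_pos one_pos (by linarith)).le),
                  one_div_mul_cancel (by linarith [hr.2]), ENNReal.ofReal_one, one_mul]
            _ ≤ _ := by
                rw [← mul_assoc]
                have : 1 ≤ 2 * ENNReal.ofReal r := by
                  rw [← ENNReal.ofReal_ofNat 2, ← ENNReal.ofReal_mul zero_le_two,
                    ENNReal.one_le_ofReal]
                  linarith [hr.1]
                exact le_mul_of_one_le_left' this
        · refine le_trans (le_of_eq ?_) zero_le
          rw [← lintegral_indicator measurableSet_Ioo, lintegral_eq_zero_iff']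
          · refine Eventually.of_forall fun s => ?_
            refine indicator_apply_eq_zero.mpr fun hs => indicator_of_notMem ?_ _
            exact fun h => hr ⟨h.1, h.2.trans_lt hs.2⟩
          · exact ((hF.comp measurable_prodMk_right).indicator measurableSet_Ioo).aemeasurable
    _ = _ := by
        rw [lintegral_indicator measurableSet_Ioo, lintegral_const_mul]
        fun_prop

theorem lintegral_radialEnergy_le {f : ℂ → ℂ} {γ : Set ℂ} (hγ : MeasurableSet γ) :
    ∫⁻ z in discSector γ, radialEnergy f z ≤
      2 * ∫⁻ z in discSector γ, ENNReal.ofReal (‖deriv f z‖ ^ 2) := by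
  have hd : Measurable (deriv f) := measurable_deriv f
  have hg : Measurable fun z => ENNReal.ofReal (‖deriv f z‖ ^ 2) := by fun_prop
  rw [lintegral_discSector hγ (measurable_radialEnergy f), lintegral_discSector hγ hg,
    ← lintegral_const_mul' _ _ (by simp)]
  refine lintegral_mono fun θ => ?_
  refine le_trans (setLIntegral_mono' measurableSet_Ioo fun s hs => ?_)
    (lintegral_mul_weighted_primitive_le
      (g := fun r : ℝ => ENNReal.ofReal (‖deriv f (r * Complex.exp (θ * Complex.I))‖ ^ 2))
      (by fun_prop))
  obtain ⟨h1, h2⟩ := inv_norm_mul_polar hs.1 θ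
  unfold radialEnergy
  rw [h2, h1]

theorem add_rpow_le_of_le_four {x y p : ℝ} (hx : 0 ≤ x) (hy : 0 ≤ y) (hp : 0 ≤ p) (hp4 : p ≤ 4) :
    (x + y) ^ p ≤ 16 * (x ^ p + y ^ p) := by
  have h2 : (2 : ℝ) ^ p ≤ 16 := by
    calc (2 : ℝ) ^ p ≤ 2 ^ (4 : ℝ) := Real.rpow_le_rpow_of_exponent_le one_le_two hp4
      _ = 16 := by norm_num
  have key : ∀ m : ℝ, 0 ≤ m → x + y ≤ 2 * m → (x + y) ^ p ≤ 16 * m ^ p := fun m hm h =>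
    calc (x + y) ^ p ≤ (2 * m) ^ p := Real.rpow_le_rpow (by positivity) h hp
      _ = 2 ^ p * m ^ p := Real.mul_rpow zero_le_two hm
      _ ≤ 16 * m ^ p := by gcongr
  have hxp : 0 ≤ x ^ p := Real.rpow_nonneg hx p
  have hyp : 0 ≤ y ^ p := Real.rpow_nonneg hy p
  rcases le_total x y with h | h
  · linarith [key y hy (by linarith)]
  · linarith [key x hx (by linarith)]

theorem rpow_mul_sq_le {x δ d A α ρ : ℝ} (hx : 0 ≤ x) (hδ : 0 < δ) (hδd : δ ≤ d) (hd : d ≤ 1)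
    (hα : 0 < α) (hρ : 1 < ρ) (hxδ : x ≤ δ ^ α) (hA0 : 0 ≤ A) (hA : A * δ ≤ 8 * |Real.log d|) :
    x ^ (2 * ρ) * A ^ 2 ≤ 64 / (α * (ρ - 1)) ^ 2 * (x ^ 2 / δ ^ 2) := by
  have hε : 0 < α * (ρ - 1) := mul_pos hα (by linarith)
  have hlog : |Real.log d| ≤ |Real.log δ| := by
    rw [abs_of_nonpos (Real.log_nonpos (by linarith) hd),
      abs_of_nonpos (Real.log_nonpos hδ.le (by linarith))]
    linarith [Real.log_le_log hδ hδd]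
  have hpow : x ^ (2 * ρ) ≤ x ^ 2 * (δ ^ (α * (ρ - 1))) ^ 2 := by
    have : 2 * ρ = 2 + (ρ - 1) * 2 := by ring
    rw [this, Real.rpow_add_of_nonneg hx (by norm_num) (by linarith), Real.rpow_mul hx,
      Real.rpow_two, Real.rpow_two]
    have h1 : x ^ (ρ - 1) ≤ δ ^ (α * (ρ - 1)) := by
      rw [Real.rpow_mul hδ.le]
      exact Real.rpow_le_rpow hx hxδ (by linarith)
    have h0 : 0 ≤ x ^ (ρ - 1) := Real.rpow_nonneg hx _
    gcongr
  have hpos : 0 < δ ^ (α * (ρ - 1)) := Real.rpow_pos_of_pos hδ _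
  have hB : δ ^ (α * (ρ - 1)) * A * δ ≤ 8 * (1 / (α * (ρ - 1))) := by
    have h1 := (Real.abs_log_mul_self_rpow_lt δ _ hδ (hδd.trans hd) hε).le
    rw [abs_mul, abs_of_pos hpos] at h1
    calc δ ^ (α * (ρ - 1)) * A * δ = δ ^ (α * (ρ - 1)) * (A * δ) := by ring
      _ ≤ δ ^ (α * (ρ - 1)) * (8 * |Real.log δ|) :=
        mul_le_mul_of_nonneg_left (by linarith) hpos.le
      _ = 8 * (|Real.log δ| * δ ^ (α * (ρ - 1))) := by ring
      _ ≤ _ := by gcongr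
  have hB2 : (δ ^ (α * (ρ - 1)) * A * δ) ^ 2 ≤ 64 / (α * (ρ - 1)) ^ 2 := by
    calc _ ≤ (8 * (1 / (α * (ρ - 1)))) ^ 2 := by gcongr
      _ = _ := by rw [mul_pow, div_pow]; ring
  calc x ^ (2 * ρ) * A ^ 2 ≤ x ^ 2 * (δ ^ (α * (ρ - 1))) ^ 2 * A ^ 2 := by gcongr
    _ = (δ ^ (α * (ρ - 1)) * A * δ) ^ 2 * (x ^ 2 / δ ^ 2) := by field_simp
    _ ≤ _ := by gcongr

theorem sector22_pointwise {α ρ : ℝ} (hα0 : 0 < α) (hρ1 : 1 < ρ) (hρ2 : ρ ≤ 2) {f : ℂ → ℂ}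
    (hf : IsOuter f) (hf1 : ∀ z ∈ closedBall (0 : ℂ) 1, ‖f z‖ ≤ 1)
    (hlog : IntervalIntegrable (fun θ : ℝ => Real.log ‖f (Complex.exp (θ * Complex.I))‖) volume
      0 (2 * Real.pi)) {η : ℝ} (hη : 0 < η)
    (hlip : ∀ z ∈ closedBall (0 : ℂ) 1, ∀ w ∈ closedBall (0 : ℂ) 1,
      ‖z - w‖ < η → ‖f z - f w‖ ≤ ‖z - w‖ ^ α) {M : ℝ}
    (hM : M = (1 / (2 * Real.pi)) * ∫ θ in Ico 0 (2 * Real.pi),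
      -Real.log ‖f (Complex.exp (θ * Complex.I))‖)
    {Γ γ : Set ℂ} (hΓ : IsArcUnion f Γ) (hγ : IsCompArc f γ) {a b : ℂ}
    (hcl : closure γ = insert a (insert b γ))
    (hd : ∀ z ∈ sector2 a b γ, dd a b z ≤ 1 / 2) {z : ℂ} (hz : z ∈ sector22 f Γ γ a b) :
    ENNReal.ofReal (‖f z‖ ^ (2 * ρ) * aFun f Γ γ z ^ 2) ≤
      ENNReal.ofReal (1024 / (α * (ρ - 1)) ^ 2) * radialEnergy f z +
        ENNReal.ofReal (16 * M ^ 2 + M ^ 2 / η ^ 4) := by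
  obtain ⟨hz2, hlow, hupp⟩ := hz
  have hzS : z ∈ discSector γ := hz2.1
  have hd2 := hd z hz2
  have hdr := hz2.2
  have hz1 : ‖z‖ < 1 := by simpa [uDisc] using hzS.1
  have hz0 : z ≠ 0 := by
    rintro rfl
    simp at hdr
    linarith
  have hr : 0 < ‖z‖ := norm_pos_iff.mpr hz0
  have hd0 : 0 < dd a b z := by linarith
  have hMA := aFun_le hf.1 hf1 ((IntegrableOn.neg hlog.1).congr_set_ae Ico_ae_eq_Ioc) hΓ hγ hcl
    hzS hd0
  rw [← hM] at hMA
  set d := dd a b z with hddef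
  set A := aFun f Γ γ z with hAdef
  have hlogd : Real.log d < 0 := Real.log_neg hd0 (by linarith)
  have habs : 0 < |Real.log d| := abs_pos.mpr hlogd.ne
  have hA0 : 0 < A := lt_trans (by positivity) hlow
  set δ := 8 * |Real.log d| / A with hδdef
  have hδ0 : 0 < δ := by positivity
  have hAδ : A * δ = 8 * |Real.log d| := mul_div_cancel₀ _ hA0.ne'
  have hδd : δ ≤ d := by
    rw [hδdef, div_le_iff₀ hA0]
    rw [div_lt_iff₀ hd0] at hlow
    linarith
  have hδr : 1 - ‖z‖ ≤ δ := by
    rw [hδdef, le_div_iff₀ hA0]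
    rw [lt_div_iff₀ (by linarith)] at hupp
    linarith
  have hE := ofReal_div_le_radialEnergy hf.1.1 hz0 hzS.1 (hδd.trans hd2) hδr
  set ζ : ℂ := (‖z‖ : ℂ)⁻¹ * z with hζ
  have hζ1 : ‖ζ‖ = 1 := by
    rw [hζ, norm_mul, norm_inv, Complex.norm_real, norm_norm, inv_mul_cancel₀ hr.ne']
  have hzζ : z = (‖z‖ : ℝ) * ζ := by
    rw [hζ, mul_inv_cancel_left₀]
    exact_mod_cast hr.ne'
  set w : ℂ := (1 - δ : ℝ) * ζ with hw
  have hwn : ‖w‖ = 1 - δ := by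
    rw [hw, norm_mul, hζ1, mul_one, Complex.norm_real, Real.norm_eq_abs, abs_of_nonneg]
    linarith
  have hwD : w ∈ uDisc := by
    rw [uDisc, mem_ball_zero_iff, hwn]; linarith
  have hzw : ‖z - w‖ = ‖z‖ - (1 - δ) := by
    conv_lhs => rw [hzζ, hw, ← sub_mul, ← Complex.ofReal_sub, norm_mul, hζ1, mul_one,
      Complex.norm_real, Real.norm_eq_abs]
    rw [abs_of_nonneg (by linarith)]
  have hzwδ : ‖z - w‖ ≤ δ := by linarith
  have hzC : z ∈ closedBall (0 : ℂ) 1 := ball_subset_closedBall hzS.1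
  have hwC : w ∈ closedBall (0 : ℂ) 1 := ball_subset_closedBall hwD
  have hM0 : 0 ≤ M := by
    have : 0 < M / d ^ 2 := hA0.trans_le hMA
    by_contra! h
    exact absurd this (div_nonpos_of_nonpos_of_nonneg h.le (by positivity)).not_gt
  have hfw : ‖f w‖ ≤ d ^ 2 := by
    refine (norm_le_exp_aFun hf hf1 hlog hΓ hγ hcl hzS hwD (hzwδ.trans hδd)).trans_eq ?_
    rw [hwn, ← hAdef]
    have : -((1 - (1 - δ)) / 4 * A) = Real.log d * (2 : ℝ) := by
      have h4 : (1 - (1 - δ)) / 4 * A = A * δ / 4 := by ring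
      rw [h4, hAδ, abs_of_neg hlogd]
      ring
    rw [this, ← Real.rpow_def_of_pos hd0, Real.rpow_two]
  have hfz1 : ‖f z‖ ^ (2 * ρ) ≤ 1 := Real.rpow_le_one (norm_nonneg _) (hf1 z hzC) (by linarith)
  have hA2 : A ^ 2 ≤ M ^ 2 / d ^ 4 := by
    calc A ^ 2 ≤ (M / d ^ 2) ^ 2 := by gcongr
      _ = M ^ 2 / d ^ 4 := by rw [div_pow, ← pow_mul]
  set E := ‖f z - f w‖ ^ 2 / δ ^ 2 with hEdef
  have hE0 : 0 ≤ E := by positivity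
  have hK0 : 0 ≤ 1024 / (α * (ρ - 1)) ^ 2 := by positivity
  have hreal : ‖f z‖ ^ (2 * ρ) * A ^ 2 ≤
      1024 / (α * (ρ - 1)) ^ 2 * E + (16 * M ^ 2 + M ^ 2 / η ^ 4) := by
    rcases lt_or_ge ‖z - w‖ η with hlt | hge
    · have hx : ‖f z - f w‖ ≤ δ ^ α := (hlip z hzC w hwC hlt).trans
        (Real.rpow_le_rpow (norm_nonneg _) hzwδ hα0.le)
      have h1 := rpow_mul_sq_le (norm_nonneg _) hδ0 hδd (by linarith) hα0 hρ1 hx hA0.le hAδ.le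
      have h2 : ‖f w‖ ^ (2 * ρ) * A ^ 2 ≤ M ^ 2 := by
        have h3 : ‖f w‖ ^ (2 * ρ) ≤ d ^ 4 := by
          calc ‖f w‖ ^ (2 * ρ) ≤ ‖f w‖ ^ (2 : ℝ) :=
                Real.rpow_le_rpow_of_exponent_ge' (norm_nonneg _) (hf1 w hwC) zero_le_two
                  (by linarith)
            _ = ‖f w‖ ^ 2 := Real.rpow_two _
            _ ≤ (d ^ 2) ^ 2 := by gcongr
            _ = d ^ 4 := by ring
        calc _ ≤ d ^ 4 * (M ^ 2 / d ^ 4) := by gcongr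
          _ = M ^ 2 := mul_div_cancel₀ _ (by positivity)
      have h4 : ‖f z‖ ^ (2 * ρ) ≤ 16 * (‖f z - f w‖ ^ (2 * ρ) + ‖f w‖ ^ (2 * ρ)) := by
        refine le_trans (Real.rpow_le_rpow (norm_nonneg _) ?_ (by linarith))
          (add_rpow_le_of_le_four (norm_nonneg _) (norm_nonneg _) (by linarith) (by linarith))
        simpa using norm_add_le (f z - f w) (f w)
      have h5 : 0 ≤ M ^ 2 / η ^ 4 := by positivity
      calc _ ≤ 16 * (‖f z - f w‖ ^ (2 * ρ) + ‖f w‖ ^ (2 * ρ)) * A ^ 2 := by gcongr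
        _ = 16 * (‖f z - f w‖ ^ (2 * ρ) * A ^ 2) + 16 * (‖f w‖ ^ (2 * ρ) * A ^ 2) := by ring
        _ ≤ 16 * (64 / (α * (ρ - 1)) ^ 2 * E) + 16 * M ^ 2 := by gcongr
        _ = 1024 / (α * (ρ - 1)) ^ 2 * E + 16 * M ^ 2 := by ring
        _ ≤ _ := by linarith
    · have hηd : η ≤ d := hge.trans (hzwδ.trans hδd)
      have h1 : A ^ 2 ≤ M ^ 2 / η ^ 4 := hA2.trans (by gcongr)
      calc _ ≤ 1 * A ^ 2 := by gcongr
        _ ≤ _ := by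
          have : 0 ≤ M ^ 2 := sq_nonneg M
          nlinarith [mul_nonneg hK0 hE0]
  calc _ ≤ ENNReal.ofReal (1024 / (α * (ρ - 1)) ^ 2 * E + (16 * M ^ 2 + M ^ 2 / η ^ 4)) :=
        ENNReal.ofReal_le_ofReal hreal
    _ = ENNReal.ofReal (1024 / (α * (ρ - 1)) ^ 2) * ENNReal.ofReal E +
        ENNReal.ofReal (16 * M ^ 2 + M ^ 2 / η ^ 4) := by
        rw [ENNReal.ofReal_add (by positivity) (by positivity), ENNReal.ofReal_mul hK0]
    _ ≤ _ := by gcongr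

/-- `∫_{Δ_γ²²} |f|^{2ρ} a_γ² dA ≤ C_ρ ‖f'‖²_{L²(Δ_γ)} + C·A(Δ_γ)`. -/
theorem sector22_est (α ρ : ℝ) (hα0 : 0 < α) (hα1 : α ≤ 1/2) (hρ1 : 1 < ρ) (hρ2 : ρ ≤ 2) :
    ∃ Cρ : ℝ, 0 < Cρ ∧ ∀ f : ℂ → ℂ, MemA α f → IsOuter f → ANorm α f ≤ 1 →
      ∃ C : ℝ, 0 < C ∧ ∀ (Γ γ : Set ℂ) (a b : ℂ),
        IsArcUnion f Γ →
        IsCompArc f γ → volume (angSet γ) < ENNReal.ofReal (1/2) →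
        a ∈ bZeros f → b ∈ bZeros f → closure γ = insert a (insert b γ) →
        (∀ z ∈ sector2 a b γ, dd a b z ≤ 1/2) →
        nlint (sector22 f Γ γ a b)
            (fun z => ‖f z‖ ^ (2 * ρ) * (aFun f Γ γ z) ^ 2) ≤
          ENNReal.ofReal Cρ * nlint (discSector γ) (fun z => ‖deriv f z‖ ^ 2) +
            ENNReal.ofReal C * nlint (discSector γ) (fun _ => 1) := by
  have hε : 0 < α * (ρ - 1) := mul_pos hα0 (by linarith)
  refine ⟨2 * (1024 / (α * (ρ - 1)) ^ 2), by positivity, fun f hA hf hnorm => ?_⟩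
  have hf1 : ∀ z ∈ closedBall (0 : ℂ) 1, ‖f z‖ ≤ 1 := fun z hz =>
    norm_le_one_of_ANorm_le_one hf.1 hnorm hz
  obtain ⟨η, hη, hlip⟩ := hA.2.2 1 one_pos
  simp only [one_mul] at hlip
  set M := (1 / (2 * Real.pi)) * ∫ θ in Ico 0 (2 * Real.pi),
    -Real.log ‖f (Complex.exp (θ * Complex.I))‖ with hM
  refine ⟨16 * M ^ 2 + M ^ 2 / η ^ 4 + 1, by positivity, fun Γ γ a b hΓ hγ _ ha hb hcl hd => ?_⟩
  have hγm := measurableSet_of_closure_eq hcl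
  have hlog := hf.intervalIntegrable_log ha
  set K := 1024 / (α * (ρ - 1)) ^ 2
  set C := 16 * M ^ 2 + M ^ 2 / η ^ 4
  have hsub : sector22 f Γ γ a b ⊆ discSector γ := fun z hz => hz.1.1
  have key : ∫⁻ z in sector22 f Γ γ a b,
      ENNReal.ofReal (‖f z‖ ^ (2 * ρ) * aFun f Γ γ z ^ 2) ≤
      ENNReal.ofReal (2 * K) * (∫⁻ z in discSector γ, ENNReal.ofReal (‖deriv f z‖ ^ 2)) +
        ENNReal.ofReal (C + 1) * ∫⁻ _ in discSector γ, ENNReal.ofReal 1 := by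
    have hmeas := measurable_radialEnergy f
    calc _ ≤ ∫⁻ z in sector22 f Γ γ a b,
          (ENNReal.ofReal K * radialEnergy f z + ENNReal.ofReal C) :=
          setLIntegral_mono (by fun_prop) fun z hz =>
            sector22_pointwise hα0 hρ1 hρ2 hf hf1 hlog hη hlip hM hΓ hγ hcl hd hz
      _ ≤ ∫⁻ z in discSector γ, (ENNReal.ofReal K * radialEnergy f z + ENNReal.ofReal C) :=
          lintegral_mono_set hsub
      _ = ENNReal.ofReal K * (∫⁻ z in discSector γ, radialEnergy f z) +
          ENNReal.ofReal C * ∫⁻ _ in discSector γ, ENNReal.ofReal 1 := by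
          rw [lintegral_add_right _ measurable_const, lintegral_const_mul _ hmeas,
            lintegral_const, ENNReal.ofReal_one, lintegral_one]
      _ ≤ ENNReal.ofReal K * (2 * ∫⁻ z in discSector γ, ENNReal.ofReal (‖deriv f z‖ ^ 2)) +
          ENNReal.ofReal (C + 1) * ∫⁻ _ in discSector γ, ENNReal.ofReal 1 := by
          gcongr
          · exact lintegral_radialEnergy_le hγm
          · linarith
      _ = _ := by
          rw [ENNReal.ofReal_mul zero_le_two, ENNReal.ofReal_ofNat]
          ring
  unfold nlint
  calc _ ≤ ENNReal.ofReal (1 / Real.pi) * _ := mul_le_mul_right key _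
    _ = _ := by ring
end

section
/- Let 0 < α ≤ 1/2, let f ∈ 𝒜_α be outer with ‖f‖_{𝒜_α} ≤ 1, and let 1 < ρ ≤ 2. Then there is a constant C_ρ > 0 depending only on ρ and α such that for every union Γ of component arcs of 𝕋\E_f, ∫_𝔻 |f(z)|^{2ρ} |f_Γ'(z)|² dA(z) ≤ C_ρ. -/
open Complex MeasureTheory Set Metric Filter
open scoped ENNReal Classical

theorem exists_lintegral_norm_sub_rpow_le {s : ℝ} (hs : s < 2) :
    ∃ C : ℝ, 0 < C ∧ ∀ w ∈ uDisc,
      ∫⁻ z in uDisc, ENNReal.ofReal (‖w - z‖ ^ (-s)) ≤ ENNReal.ofReal C := by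
  have hint : IntegrableOn (fun x : ℂ => ‖x‖ ^ (-s)) (ball 0 2) volume := by
    refine integrableOn_ball_of_norm_le_rpow (C := 1) (α := s) ?_ ?_ ?_ ?_
    · simp [Complex.finrank_real_complex]
    · simpa [Complex.finrank_real_complex] using hs
    · filter_upwards with x
      rw [Real.norm_of_nonneg (by positivity), one_mul]
    · exact (by fun_prop : Measurable fun x : ℂ => ‖x‖ ^ (-s)).aestronglyMeasurable
  refine ⟨(∫ x in ball (0 : ℂ) 2, ‖x‖ ^ (-s)) + 1, ?_, fun w hw => ?_⟩
  · have : 0 ≤ ∫ x in ball (0 : ℂ) 2, ‖x‖ ^ (-s) := integral_nonneg fun x => by positivity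
    linarith
  · have hw' : ‖w‖ < 1 := by simpa [uDisc] using hw
    calc ∫⁻ z in uDisc, ENNReal.ofReal (‖w - z‖ ^ (-s))
        = ∫⁻ z, uDisc.indicator (fun z => ENNReal.ofReal (‖w - z‖ ^ (-s))) z := by
          rw [lintegral_indicator]; exact measurableSet_ball
      _ ≤ ∫⁻ z, (ball (0 : ℂ) 2).indicator (fun x => ENNReal.ofReal (‖x‖ ^ (-s))) (w - z) := by
          refine lintegral_mono fun z => ?_
          by_cases hz : z ∈ uDisc
          · have hz' : ‖z‖ < 1 := by simpa [uDisc] using hz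
            rw [Set.indicator_of_mem hz, Set.indicator_of_mem]
            rw [mem_ball_zero_iff]
            linarith [norm_sub_le w z]
          · rw [Set.indicator_of_notMem hz]
            exact zero_le
      _ = ∫⁻ x, (ball (0 : ℂ) 2).indicator (fun x => ENNReal.ofReal (‖x‖ ^ (-s))) x :=
          lintegral_sub_left_eq_self _ w
      _ = ENNReal.ofReal (∫ x in ball (0 : ℂ) 2, ‖x‖ ^ (-s)) := by
          rw [lintegral_indicator measurableSet_ball, ofReal_integral_eq_lintegral_ofReal hint]
          filter_upwards with x
          positivity
      _ ≤ _ := ENNReal.ofReal_le_ofReal (by linarith)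

theorem two_pi_mul_norm_sq_le_lintegral_circle {g : ℂ → ℂ} {w : ℂ} {s r : ℝ}
    (hg : DifferentiableOn ℂ g (ball w s)) (hr0 : 0 < r) (hr : r < s) :
    ENNReal.ofReal (2 * Real.pi * ‖g w‖ ^ 2) ≤
      ∫⁻ θ in Ioo (-Real.pi) Real.pi,
        ENNReal.ofReal (‖g (w + r * (Real.cos θ + Real.sin θ * I))‖ ^ 2) := by
  have hcm : ∀ θ : ℝ, w + r * (Real.cos θ + Real.sin θ * I) = circleMap w r θ := fun θ => by
    simp [circleMap, Complex.exp_mul_I]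
  have hcont : ContinuousOn (fun z => g z ^ 2) (ball w s) := (hg.pow 2).continuousOn
  have hav : Real.circleAverage (fun z => g z ^ 2) w r = g w ^ 2 := by
    apply DiffContOnCl.circleAverage
    rw [abs_of_pos hr0]
    exact ((hg.pow 2).mono (closedBall_subset_ball hr)).diffContOnCl_ball subset_rfl
  have hcc : Continuous fun θ : ℝ => g (circleMap w r θ) ^ 2 := by
    refine hcont.comp_continuous (continuous_circleMap w r) fun θ => ?_
    simp [circleMap, abs_of_pos hr0, hr, mem_ball, dist_eq_norm]
  have hper : ∫ θ in (0:ℝ)..(2 * Real.pi), ‖g (circleMap w r θ) ^ 2‖ =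
      ∫ θ in (-Real.pi)..Real.pi, ‖g (circleMap w r θ) ^ 2‖ := by
    have hp : Function.Periodic (fun θ : ℝ => ‖g (circleMap w r θ) ^ 2‖) (2 * Real.pi) :=
      fun θ => by simp only [periodic_circleMap w r θ]
    have := hp.intervalIntegral_add_eq 0 (-Real.pi)
    rw [zero_add] at this
    rw [this]
    congr 1
    ring
  have hle : 2 * Real.pi * ‖g w‖ ^ 2 ≤ ∫ θ in (-Real.pi)..Real.pi, ‖g (circleMap w r θ) ^ 2‖ := by
    rw [← hper, ← norm_pow, ← hav, Real.circleAverage_def, norm_smul, Real.norm_of_nonneg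
      (by positivity), ← mul_assoc, mul_inv_cancel₀ (by positivity), one_mul]
    exact intervalIntegral.norm_integral_le_integral_norm (by positivity)
  refine (ENNReal.ofReal_le_ofReal hle).trans ?_
  rw [intervalIntegral.integral_of_le (by linarith [Real.pi_pos]),
    integral_Ioc_eq_integral_Ioo, ofReal_integral_eq_lintegral_ofReal]
  · simp only [hcm, norm_pow, le_refl]
  · exact (hcc.norm.integrableOn_Icc).mono_set Ioo_subset_Icc_self
  · filter_upwards with θ
    positivity

/-- Mean value inequality for `‖g‖²` over a disc. -/
theorem area_mean_value {g : ℂ → ℂ} {w : ℂ} {s : ℝ} (hs : 0 < s)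
    (hg : DifferentiableOn ℂ g (ball w s)) :
    ENNReal.ofReal (Real.pi * s ^ 2 * ‖g w‖ ^ 2) ≤
      ∫⁻ z in ball w s, ENNReal.ofReal (‖g z‖ ^ 2) := by
  set G : ℂ → ℝ≥0∞ := (ball w s).indicator fun z => ENNReal.ofReal (‖g z‖ ^ 2) with hG
  have hGm : Measurable G := by
    have h1 : ContinuousOn (fun z => ENNReal.ofReal (‖g z‖ ^ 2)) (ball w s) :=
      ENNReal.continuous_ofReal.comp_continuousOn (hg.continuousOn.norm.pow 2)
    rw [hG, ← Set.piecewise_eq_indicator]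
    exact h1.measurable_piecewise continuousOn_const measurableSet_ball
  have hpol : ∫⁻ z in ball w s, ENNReal.ofReal (‖g z‖ ^ 2) =
      ∫⁻ r in Ioi (0 : ℝ), ∫⁻ θ in Ioo (-Real.pi) Real.pi,
        ENNReal.ofReal r * G (w + r * (Real.cos θ + Real.sin θ * I)) := by
    rw [← lintegral_indicator measurableSet_ball, ← hG, ← lintegral_add_left_eq_self _ w,
      ← Complex.lintegral_comp_polarCoord_symm]
    simp only [Complex.polarCoord_symm_apply, smul_eq_mul]
    rw [polarCoord_target, Measure.volume_eq_prod, setLIntegral_prod]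
    exact (by fun_prop : Measurable _).aemeasurable
  rw [hpol]
  calc ENNReal.ofReal (Real.pi * s ^ 2 * ‖g w‖ ^ 2)
      = ∫⁻ r in Ioo 0 s, ENNReal.ofReal (r * (2 * Real.pi * ‖g w‖ ^ 2)) := by
        rw [← ofReal_integral_eq_lintegral_ofReal, ← integral_Ioc_eq_integral_Ioo,
          ← intervalIntegral.integral_of_le hs.le]
        · congr 1
          rw [intervalIntegral.integral_mul_const, integral_id]
          ring
        · exact (Continuous.integrableOn_Icc (by fun_prop)).mono_set Ioo_subset_Icc_self
        · filter_upwards [ae_restrict_mem measurableSet_Ioo] with r hr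
          have := hr.1
          positivity
    _ ≤ ∫⁻ r in Ioo 0 s, ∫⁻ θ in Ioo (-Real.pi) Real.pi,
        ENNReal.ofReal r * G (w + r * (Real.cos θ + Real.sin θ * I)) := by
        refine setLIntegral_mono' measurableSet_Ioo fun r hr => ?_
        rw [lintegral_const_mul _ (by fun_prop), ENNReal.ofReal_mul hr.1.le]
        gcongr
        refine (two_pi_mul_norm_sq_le_lintegral_circle hg hr.1 hr.2).trans
          (lintegral_mono fun θ => ?_)
        rw [hG, Set.indicator_of_mem]
        have : ‖(Real.cos θ + Real.sin θ * I : ℂ)‖ = 1 := by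
          rw [Complex.ofReal_cos, Complex.ofReal_sin, ← Complex.exp_mul_I,
            Complex.norm_exp_ofReal_mul_I]
        simp only [mem_ball, dist_eq_norm, add_sub_cancel_left, norm_mul, this]
        simpa [abs_of_pos hr.1] using hr.2
    _ ≤ _ := lintegral_mono_set fun r hr => hr.1

/-- The normalized Schwarz integral over `S` of the boundary data `φ`. -/
noncomputable def schwarzInt (S : Set ℝ) (φ : ℝ → ℝ) (z : ℂ) : ℂ :=
  (1 / (2 * (Real.pi : ℂ))) * ∫ θ in S, circleKernel z θ * (φ θ : ℂ)

/-- The integral of `-φ` over `S` against the inverse square of the distance to `z`. -/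
noncomputable def invSqInt (S : Set ℝ) (φ : ℝ → ℝ) (z : ℂ) : ℝ :=
  (1 / (2 * Real.pi)) * ∫ θ in S, -φ θ / ‖Complex.exp ((θ : ℂ) * I) - z‖ ^ 2

theorem one_sub_norm_le_norm_exp_sub (z : ℂ) (θ : ℝ) :
    1 - ‖z‖ ≤ ‖Complex.exp ((θ : ℂ) * I) - z‖ := by
  simpa [Complex.norm_exp_ofReal_mul_I] using norm_sub_norm_le (Complex.exp ((θ : ℂ) * I)) z

theorem exp_sub_ne_zero {z : ℂ} (hz : ‖z‖ < 1) (θ : ℝ) :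
    Complex.exp ((θ : ℂ) * I) - z ≠ 0 := by
  rw [← norm_pos_iff]
  linarith [one_sub_norm_le_norm_exp_sub z θ]

theorem continuous_circleKernel_s16 {z : ℂ} (hz : ‖z‖ < 1) : Continuous (circleKernel z) :=
  Continuous.div (by fun_prop) (by fun_prop) (exp_sub_ne_zero hz)

theorem norm_circleKernel_le {z : ℂ} (hz : ‖z‖ < 1) (θ : ℝ) :
    ‖circleKernel z θ‖ ≤ 2 / (1 - ‖z‖) := by
  rw [circleKernel, norm_div]
  have h1 := one_sub_norm_le_norm_exp_sub z θ
  have h2 : ‖Complex.exp ((θ : ℂ) * I) + z‖ ≤ 2 := by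
    refine (norm_add_le _ _).trans ?_
    rw [Complex.norm_exp_ofReal_mul_I]
    linarith
  have : 0 < 1 - ‖z‖ := by linarith
  gcongr

theorem circleKernel_re (z : ℂ) (θ : ℝ) :
    (circleKernel z θ).re = (1 - ‖z‖ ^ 2) / ‖Complex.exp ((θ : ℂ) * I) - z‖ ^ 2 := by
  have h := congrFun (poissonKernel_eq_re_herglotzRieszKernel (c := 0) (w := z))
    (Complex.exp ((θ : ℂ) * I))
  simp only [Function.comp_apply, poissonKernel_def, herglotzRieszKernel_def, sub_zero,
    Complex.norm_exp_ofReal_mul_I, one_pow] at h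
  exact h.symm

theorem integrableOn_circleKernel_mul {S : Set ℝ} {φ : ℝ → ℝ} (hφ : IntegrableOn φ S) {z : ℂ}
    (hz : ‖z‖ < 1) : IntegrableOn (fun θ => circleKernel z θ * (φ θ : ℂ)) S :=
  Integrable.bdd_mul hφ.ofReal (continuous_circleKernel_s16 hz).aestronglyMeasurable
    (ae_of_all _ (norm_circleKernel_le hz))

theorem integrableOn_div_norm_sq_s16 {S : Set ℝ} {φ : ℝ → ℝ} (hφ : IntegrableOn φ S) {z : ℂ}
    (hz : ‖z‖ < 1) :
    IntegrableOn (fun θ => -φ θ / ‖Complex.exp ((θ : ℂ) * I) - z‖ ^ 2) S := by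
  simp_rw [div_eq_mul_inv]
  refine Integrable.mul_bdd (c := ((1 - ‖z‖) ^ 2)⁻¹) hφ.neg ?_ (ae_of_all _ fun θ => ?_)
  · refine (Continuous.inv₀ (by fun_prop) fun θ => ?_).aestronglyMeasurable
    have := exp_sub_ne_zero hz θ
    positivity
  · have h1 := one_sub_norm_le_norm_exp_sub z θ
    have h2 : 0 < 1 - ‖z‖ := by linarith
    rw [Real.norm_of_nonneg (by positivity)]
    gcongr

theorem schwarzInt_re {S : Set ℝ} {φ : ℝ → ℝ} (hφ : IntegrableOn φ S) {z : ℂ} (hz : ‖z‖ < 1) :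
    (schwarzInt S φ z).re = -((1 - ‖z‖ ^ 2) * invSqInt S φ z) := by
  have h1 : (1 / (2 * (Real.pi : ℂ))) = ((1 / (2 * Real.pi) : ℝ) : ℂ) := by push_cast; ring
  have h2 : (∫ θ in S, circleKernel z θ * (φ θ : ℂ)).re =
      ∫ θ in S, (circleKernel z θ * (φ θ : ℂ)).re :=
    (integral_re (𝕜 := ℂ) (integrableOn_circleKernel_mul hφ hz)).symm
  rw [schwarzInt, h1, Complex.re_ofReal_mul, h2, invSqInt, mul_left_comm, ← mul_neg,
    ← neg_mul, ← integral_const_mul (-(1 - ‖z‖ ^ 2))]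
  refine congrArg (fun x : ℝ => 1 / (2 * Real.pi) * x)
    (integral_congr_ae (ae_of_all _ fun θ => ?_))
  simp only [Complex.re_mul_ofReal, circleKernel_re]
  ring

theorem invSqInt_nonneg {S : Set ℝ} {φ : ℝ → ℝ} (hφ : ∀ θ, φ θ ≤ 0) (z : ℂ) :
    0 ≤ invSqInt S φ z :=
  mul_nonneg (by positivity) (integral_nonneg fun θ => div_nonneg (by simpa using hφ θ)
    (by positivity))

theorem hasDerivAt_schwarzInt {S : Set ℝ} {φ : ℝ → ℝ} (hφ : IntegrableOn φ S) {z : ℂ}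
    (hz : ‖z‖ < 1) :
    HasDerivAt (schwarzInt S φ) ((1 / (2 * (Real.pi : ℂ))) *
      ∫ θ in S, 2 * Complex.exp ((θ : ℂ) * I) / (Complex.exp ((θ : ℂ) * I) - z) ^ 2 * (φ θ : ℂ))
      z := by
  set r := (1 + ‖z‖) / 2 with hr
  have hr1 : r < 1 := by linarith
  have hzr : z ∈ ball (0 : ℂ) r := by rw [mem_ball_zero_iff]; linarith
  refine HasDerivAt.const_mul _ (hasDerivAt_integral_of_dominated_loc_of_deriv_le
    (𝕜 := ℂ) (F := fun w θ => circleKernel w θ * (φ θ : ℂ)) (F' := fun w θ =>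
      2 * Complex.exp ((θ : ℂ) * I) / (Complex.exp ((θ : ℂ) * I) - w) ^ 2 * (φ θ : ℂ))
    (bound := fun θ => 2 / (1 - r) ^ 2 * ‖φ θ‖) (isOpen_ball.mem_nhds hzr) ?_
    (integrableOn_circleKernel_mul hφ hz) ?_ ?_ (hφ.norm.const_mul _) ?_).2
  · filter_upwards [isOpen_ball.mem_nhds hzr] with w hw
    rw [mem_ball_zero_iff] at hw
    exact (integrableOn_circleKernel_mul hφ (hw.trans hr1)).aestronglyMeasurable
  · refine AEStronglyMeasurable.mul ?_ hφ.ofReal.aestronglyMeasurable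
    exact (Continuous.div (by fun_prop) (by fun_prop) fun θ =>
      pow_ne_zero 2 (exp_sub_ne_zero hz θ)).aestronglyMeasurable
  · refine ae_of_all _ fun θ w hw => ?_
    rw [mem_ball_zero_iff] at hw
    have h1 := one_sub_norm_le_norm_exp_sub w θ
    have h2 : 0 < 1 - r := by linarith
    have h3 : 1 - r ≤ ‖Complex.exp ((θ : ℂ) * I) - w‖ := by linarith
    rw [norm_mul, norm_div, norm_mul, Complex.norm_exp_ofReal_mul_I, norm_pow, Complex.norm_real]
    simp only [Complex.norm_ofNat, mul_one]
    gcongr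
  · refine ae_of_all _ fun θ w hw => ?_
    rw [mem_ball_zero_iff] at hw
    have h1 := exp_sub_ne_zero (hw.trans hr1) θ
    refine HasDerivAt.mul_const ?_ _
    have h3 := ((hasDerivAt_id' w).const_add (Complex.exp ((θ : ℂ) * I))).div
      ((hasDerivAt_id' w).const_sub (Complex.exp ((θ : ℂ) * I))) h1
    exact h3.congr_deriv (by ring)

theorem norm_deriv_schwarzInt_le {S : Set ℝ} {φ : ℝ → ℝ} (hφ : IntegrableOn φ S)
    (hφ0 : ∀ θ, φ θ ≤ 0) {z : ℂ} (hz : ‖z‖ < 1) :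
    ‖deriv (schwarzInt S φ) z‖ ≤ 2 * invSqInt S φ z := by
  rw [(hasDerivAt_schwarzInt hφ hz).deriv, norm_mul, invSqInt, mul_left_comm]
  have h1 : ‖(1 / (2 * (Real.pi : ℂ)))‖ = 1 / (2 * Real.pi) := by
    simp [abs_of_pos Real.pi_pos]
  rw [h1, ← integral_const_mul (2 : ℝ)]
  gcongr
  refine norm_integral_le_of_norm_le ((integrableOn_div_norm_sq_s16 hφ hz).const_mul 2)
    (ae_of_all _ fun θ => le_of_eq ?_)
  rw [norm_mul, norm_div, norm_mul, Complex.norm_exp_ofReal_mul_I, norm_pow, Complex.norm_real,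
    Real.norm_of_nonpos (hφ0 θ)]
  simp only [Complex.norm_ofNat]
  ring

theorem invSqInt_le_four_mul {S : Set ℝ} (hS : MeasurableSet S) {φ : ℝ → ℝ}
    (hφ : IntegrableOn φ S) (hφ0 : ∀ θ, φ θ ≤ 0) {z w : ℂ} (hz : ‖z‖ < 1) (hw : ‖w‖ < 1)
    (h : ∀ θ ∈ S, ‖Complex.exp ((θ : ℂ) * I) - w‖ ≤ 2 * ‖Complex.exp ((θ : ℂ) * I) - z‖) :
    invSqInt S φ z ≤ 4 * invSqInt S φ w := by
  rw [invSqInt, invSqInt, mul_left_comm, ← integral_const_mul (4 : ℝ)]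
  refine mul_le_mul_of_nonneg_left ?_ (by positivity)
  refine setIntegral_mono_on (integrableOn_div_norm_sq_s16 hφ hz)
    ((integrableOn_div_norm_sq_s16 hφ hw).const_mul 4) hS fun θ hθ => ?_
  have h1 := norm_pos_iff.2 (exp_sub_ne_zero hz θ)
  have h2 := norm_pos_iff.2 (exp_sub_ne_zero hw θ)
  have h3 : ‖Complex.exp ((θ : ℂ) * I) - w‖ ^ 2 ≤ 4 * ‖Complex.exp ((θ : ℂ) * I) - z‖ ^ 2 := by
    nlinarith [h θ hθ]
  have h4 : 0 ≤ -φ θ := by simpa using hφ0 θ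
  rw [← mul_div_assoc, div_le_div_iff₀ (by positivity) (by positivity)]
  nlinarith

theorem IsDiscReg.bddAbove_norm {f : ℂ → ℂ} (hf : IsDiscReg f) :
    BddAbove ((fun z => ‖f z‖) '' uDisc) :=
  ((isCompact_closedBall (0 : ℂ) 1).bddAbove_image hf.2.norm).mono
    (image_mono ball_subset_closedBall)

theorem MemLip.bddAbove_deriv {α : ℝ} {f : ℂ → ℂ} (hα1 : α ≤ 1) (hf : MemLip α f) :
    BddAbove ((fun z => (1 - ‖z‖) ^ (1 - α) * ‖deriv f z‖) '' uDisc) := by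
  obtain ⟨δ, hδ, hL⟩ := hf.2 1 one_pos
  refine ⟨(2 + 2 / δ) ^ (1 - α), ?_⟩
  rintro _ ⟨z, hz, rfl⟩
  have hz1 : ‖z‖ < 1 := by simpa [uDisc] using hz
  set r := min ((1 - ‖z‖) / 2) (δ / 2) with hr
  have hr0 : 0 < r := lt_min (by linarith) (by linarith)
  have hr1 : r ≤ (1 - ‖z‖) / 2 := min_le_left _ _
  have hr2 : r ≤ δ / 2 := min_le_right _ _
  have hsub : closedBall z r ⊆ uDisc := fun w hw => by
    rw [mem_closedBall, dist_eq_norm] at hw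
    rw [uDisc, mem_ball_zero_iff]
    linarith [norm_le_norm_add_norm_sub' w z]
  have hder : ‖deriv f z‖ ≤ r ^ α / r := by
    have h1 := Complex.norm_deriv_le_of_forall_mem_sphere_norm_le (f := fun w => f w - f z)
      (c := z) (C := r ^ α) hr0 ?_ fun w hw => ?_
    · simpa using h1
    · exact (((hf.1.1.sub_const (f z)).mono hsub).diffContOnCl_ball subset_rfl)
    · have hwz : ‖w - z‖ = r := by simpa [dist_eq_norm] using hw
      have := hL w (ball_subset_closedBall (hsub (sphere_subset_closedBall hw))) z
        (ball_subset_closedBall hz) (by linarith)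
      rwa [hwz, one_mul] at this
  have hle : 1 - ‖z‖ ≤ (2 + 2 / δ) * r := by
    rcases min_choice ((1 - ‖z‖) / 2) (δ / 2) with h | h
    · have : 0 ≤ 2 / δ * r := by positivity
      have h' : r = (1 - ‖z‖) / 2 := h
      linarith
    · have h' : r = δ / 2 := h
      rw [h']
      have : (2 + 2 / δ) * (δ / 2) = δ + 1 := by field_simp
      rw [this]
      linarith [norm_nonneg z]
  calc (1 - ‖z‖) ^ (1 - α) * ‖deriv f z‖
      ≤ ((2 + 2 / δ) * r) ^ (1 - α) * (r ^ α / r) := by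
        gcongr
    _ = (2 + 2 / δ) ^ (1 - α) * (r ^ (1 - α) * r ^ α / r) := by
        rw [Real.mul_rpow (by positivity) hr0.le]
        ring
    _ = (2 + 2 / δ) ^ (1 - α) := by
        rw [← Real.rpow_add hr0, sub_add_cancel, Real.rpow_one, div_self hr0.ne', mul_one]

theorem MemA.norm_bounds {α : ℝ} {f : ℂ → ℂ} (hα1 : α ≤ 1) (hf : MemA α f)
    (hN : ANorm α f ≤ 1) :
    (∀ z ∈ closedBall (0 : ℂ) 1, ‖f z‖ ≤ 1) ∧
      (∀ z, ‖z‖ < 1 → ‖deriv f z‖ ≤ (1 - ‖z‖) ^ (α - 1)) ∧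
      ∫⁻ z in uDisc, ENNReal.ofReal (‖deriv f z‖ ^ 2) ≤ ENNReal.ofReal Real.pi := by
  have hs1 : 0 ≤ supNorm f := Real.sSup_nonneg (by rintro _ ⟨z, -, rfl⟩; positivity)
  have hs2 : 0 ≤ sSup ((fun z => (1 - ‖z‖) ^ (1 - α) * ‖deriv f z‖) '' uDisc) := by
    refine Real.sSup_nonneg ?_
    rintro _ ⟨z, hz, rfl⟩
    have : ‖z‖ < 1 := by simpa [uDisc] using hz
    have : 0 ≤ 1 - ‖z‖ := by linarith
    positivity
  have hs3 := Real.sqrt_nonneg (dirInt f)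
  rw [ANorm, lipNorm] at hN
  refine ⟨?_, fun z hz => ?_, ?_⟩
  · have hcl : closure uDisc = closedBall (0 : ℂ) 1 := closure_ball 0 one_ne_zero
    intro z hz
    have hcont : ContinuousOn (fun z => ‖f z‖) (closure uDisc) := hcl ▸ hf.2.1.2.norm
    refine closure_minimal (s := (fun z => ‖f z‖) '' uDisc) (t := Iic 1) ?_ isClosed_Iic
      (hcont.image_closure ⟨z, hcl ▸ hz, rfl⟩)
    rintro _ ⟨w, hw, rfl⟩
    have := le_csSup hf.2.1.bddAbove_norm (mem_image_of_mem _ hw)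
    rw [mem_Iic]
    change _ ≤ supNorm f at this
    linarith
  · have h0 : 0 < 1 - ‖z‖ := by linarith
    have := le_csSup (hf.2.bddAbove_deriv hα1)
      (mem_image_of_mem _ (by simpa [uDisc] using hz : z ∈ uDisc))
    have h1 : (1 - ‖z‖) ^ (1 - α) * ‖deriv f z‖ ≤ 1 := by linarith
    rw [← neg_sub 1 α, Real.rpow_neg h0.le, ← one_div, le_div_iff₀ (by positivity), mul_comm]
    exact h1
  · rw [← ofReal_integral_eq_lintegral_ofReal hf.1.2 (ae_of_all _ fun z => by positivity)]
    refine ENNReal.ofReal_le_ofReal ?_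
    have h1 : dirInt f ≤ 1 := by
      rw [← Real.sqrt_le_one]
      linarith
    rw [dirInt, one_div, inv_mul_le_iff₀ Real.pi_pos] at h1
    linarith

/-- The boundary logarithm `θ ↦ log |f(e^{iθ})|`. -/
noncomputable def bdryLog (f : ℂ → ℂ) (θ : ℝ) : ℝ :=
  Real.log ‖f (Complex.exp ((θ : ℂ) * I))‖

theorem IsOuter.eq_exp_schwarzInt {f : ℂ → ℂ} (hf : IsOuter f) {z : ℂ} (hz : ‖z‖ < 1) :
    f z = Complex.exp (schwarzInt (Ico 0 (2 * Real.pi)) (bdryLog f) z) := by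
  rw [hf.2.2 z (by simpa [uDisc] using hz), schwarzInt,
    intervalIntegral.integral_of_le (by positivity), integral_Ico_eq_integral_Ioc]
  rfl

theorem exp_mem_uCircle (θ : ℝ) : Complex.exp ((θ : ℂ) * I) ∈ uCircle := by
  simp [uCircle, Complex.norm_exp_ofReal_mul_I]

theorem IsOuter.integrableOn_bdryLog {f : ℂ → ℂ} (hf : IsOuter f) :
    IntegrableOn (bdryLog f) (Ico 0 (2 * Real.pi)) := by
  by_contra h
  have hone : ∀ z ∈ uDisc, f z = 1 := by
    intro z hz
    have hz1 : ‖z‖ < 1 := by simpa [uDisc] using hz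
    have hz2 : ‖-z‖ < 1 := by rwa [norm_neg]
    rw [hf.eq_exp_schwarzInt hz1, schwarzInt, integral_undef, mul_zero, Complex.exp_zero]
    intro hi
    refine h ?_
    have h1 : IntegrableOn (fun θ => circleKernel (-z) θ * (circleKernel z θ * (bdryLog f θ : ℂ)))
        (Ico 0 (2 * Real.pi)) :=
      Integrable.bdd_mul hi (continuous_circleKernel_s16 hz2).aestronglyMeasurable
        (ae_of_all _ (norm_circleKernel_le hz2))
    refine h1.re.congr (ae_of_all _ fun θ => ?_)
    have h2 := exp_sub_ne_zero hz1 θ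
    have h3 := exp_sub_ne_zero hz2 θ
    rw [sub_neg_eq_add] at h3
    have h4 : circleKernel (-z) θ * (circleKernel z θ * (bdryLog f θ : ℂ)) = bdryLog f θ := by
      rw [circleKernel, circleKernel, sub_neg_eq_add, ← sub_eq_add_neg]
      field_simp
    simp only [h4]
    exact Complex.ofReal_re _
  have hcl : EqOn f (fun _ => 1) (closedBall 0 1) :=
    EqOn.of_subset_closure (s := uDisc) hone hf.1.2 continuousOn_const ball_subset_closedBall
      (closure_ball (0 : ℂ) one_ne_zero).ge
  have hzero : bdryLog f = 0 := funext fun θ => by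
    simp [bdryLog, hcl (sphere_subset_closedBall (exp_mem_uCircle θ))]
  exact h (hzero ▸ integrableOn_zero)

theorem IsArcUnion.mem_of_isPreconnected {f : ℂ → ℂ} {Γ : Set ℂ} (hΓ : IsArcUnion f Γ)
    {J : Set ℝ} (hJ : IsPreconnected J) (hJf : ∀ t ∈ J, f (Complex.exp ((t : ℂ) * I)) ≠ 0)
    {a b : ℝ} (ha : a ∈ J) (hb : b ∈ J) (h : Complex.exp ((a : ℂ) * I) ∈ Γ) :
    Complex.exp ((b : ℂ) * I) ∈ Γ := by
  refine hΓ.2 _ h ?_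
  have hc : Continuous fun t : ℝ => Complex.exp ((t : ℂ) * I) := by fun_prop
  refine (hJ.image _ hc.continuousOn).subset_connectedComponentIn (mem_image_of_mem _ ha) ?_
    (mem_image_of_mem _ hb)
  rintro _ ⟨t, ht, rfl⟩
  exact ⟨exp_mem_uCircle t, hJf t ht⟩

theorem IsArcUnion.measurableSet_angSet {f : ℂ → ℂ} {Γ : Set ℂ}
    (hf : ContinuousOn f (closedBall 0 1)) (hΓ : IsArcUnion f Γ) : MeasurableSet (angSet Γ) := by
  have hopen : IsOpen {θ : ℝ | Complex.exp ((θ : ℂ) * I) ∈ Γ} := by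
    have hc : Continuous fun θ : ℝ => f (Complex.exp ((θ : ℂ) * I)) :=
      hf.comp_continuous (by fun_prop) fun θ => sphere_subset_closedBall (exp_mem_uCircle θ)
    rw [Metric.isOpen_iff]
    intro θ hθ
    obtain ⟨ε, hε, hb⟩ := Metric.isOpen_iff.1 (isOpen_ne_fun hc continuous_const) θ
      (hΓ.1 hθ).2
    exact ⟨ε, hε, fun t ht => hΓ.mem_of_isPreconnected (convex_ball θ ε).isPreconnected
      (fun s hs => hb hs) (mem_ball_self hε) ht hθ⟩
  exact measurableSet_Ico.inter hopen.measurableSet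

theorem norm_exp_sub_exp_le (s t : ℝ) :
    ‖Complex.exp ((s : ℂ) * I) - Complex.exp ((t : ℂ) * I)‖ ≤ |s - t| := by
  have h : Complex.exp ((s : ℂ) * I) - Complex.exp ((t : ℂ) * I) =
      Complex.exp ((t : ℂ) * I) * (Complex.exp (I * ((s - t : ℝ) : ℂ)) - 1) := by
    rw [mul_sub, ← Complex.exp_add, mul_one]
    congr 2
    push_cast
    ring
  rw [h, norm_mul, Complex.norm_exp_ofReal_mul_I, one_mul]
  exact Real.norm_exp_I_mul_ofReal_sub_one_le

/-- Two points of the circle that are close relative to their distance from the zero set of `f`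
lie in the same component arc. -/
theorem IsArcUnion.mem_iff_of_norm_sub_lt {f : ℂ → ℂ} {Γ : Set ℂ} (hΓ : IsArcUnion f Γ) {R : ℝ}
    {ζ ξ : ℂ} (hζ : ‖ζ‖ = 1) (hξ : ‖ξ‖ = 1) (hR : ∀ p ∈ bZeros f, 4 * R ≤ ‖p - ζ‖)
    (h : ‖ξ - ζ‖ < 2 * R) : ξ ∈ Γ ↔ ζ ∈ Γ := by
  have hR0 : 0 < R := by linarith [norm_nonneg (ξ - ζ)]
  set a := ζ.arg
  set u := (ξ / ζ).arg
  have hζ0 : ζ ≠ 0 := norm_ne_zero_iff.1 (by rw [hζ]; exact one_ne_zero)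
  have hξ0 : ξ ≠ 0 := norm_ne_zero_iff.1 (by rw [hξ]; exact one_ne_zero)
  have ha : Complex.exp ((a : ℂ) * I) = ζ := by
    simpa [hζ] using Complex.norm_mul_exp_arg_mul_I ζ
  have hu : Complex.exp ((u : ℂ) * I) = ξ / ζ := by
    simpa [hζ, hξ] using Complex.norm_mul_exp_arg_mul_I (ξ / ζ)
  have hb : Complex.exp (((a + u : ℝ) : ℂ) * I) = ξ := by
    push_cast
    rw [add_mul, Complex.exp_add, ha, hu, mul_div_cancel₀ _ hζ0]
  have hule : |u| < 4 * R := by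
    have h1 := Complex.angle_le_mul_norm_sub hξ hζ
    rw [Complex.angle_eq_abs_arg hξ0 hζ0] at h1
    nlinarith [Real.pi_pos, Real.pi_lt_four, norm_nonneg (ξ - ζ)]
  have hJf : ∀ t ∈ uIcc a (a + u), f (Complex.exp ((t : ℂ) * I)) ≠ 0 := by
    intro t ht h0
    have h1 := hR _ ⟨exp_mem_uCircle t, h0⟩
    have h2 := norm_exp_sub_exp_le t a
    rw [ha] at h2
    have h3 := abs_sub_left_of_mem_uIcc ht
    rw [add_sub_cancel_left] at h3
    linarith
  rw [← hb, ← ha]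
  exact ⟨fun h => hΓ.mem_of_isPreconnected isPreconnected_uIcc hJf right_mem_uIcc left_mem_uIcc h,
    fun h => hΓ.mem_of_isPreconnected isPreconnected_uIcc hJf left_mem_uIcc right_mem_uIcc h⟩

theorem bdryLog_nonpos {f : ℂ → ℂ} (hf1 : ∀ z ∈ closedBall (0 : ℂ) 1, ‖f z‖ ≤ 1) (θ : ℝ) :
    bdryLog f θ ≤ 0 :=
  Real.log_nonpos (norm_nonneg _) (hf1 _ (sphere_subset_closedBall (exp_mem_uCircle θ)))

theorem schwarzInt_add_diff {S T : Set ℝ} (hS : MeasurableSet S) (hST : S ⊆ T) {φ : ℝ → ℝ}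
    (hφ : IntegrableOn φ T) {z : ℂ} (hz : ‖z‖ < 1) :
    schwarzInt S φ z + schwarzInt (T \ S) φ z = schwarzInt T φ z := by
  rw [schwarzInt, schwarzInt, schwarzInt, ← mul_add, setIntegral_sdiff hS
    (integrableOn_circleKernel_mul hφ hz) hST, add_sub_cancel]

theorem norm_exp_schwarzInt_le {S : Set ℝ} {φ : ℝ → ℝ} (hφ : IntegrableOn φ S)
    (hφ0 : ∀ θ, φ θ ≤ 0) {z : ℂ} (hz : ‖z‖ < 1) :
    ‖Complex.exp (schwarzInt S φ z)‖ ≤ Real.exp (-((1 - ‖z‖) * invSqInt S φ z)) := by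
  rw [Complex.norm_exp, schwarzInt_re hφ hz]
  have h1 := invSqInt_nonneg (S := S) hφ0 z
  have h2 : 1 - ‖z‖ ≤ 1 - ‖z‖ ^ 2 := by nlinarith [norm_nonneg z]
  have := mul_le_mul_of_nonneg_right h2 h1
  exact Real.exp_le_exp.2 (by linarith)

theorem norm_exp_schwarzInt_le_one {S : Set ℝ} {φ : ℝ → ℝ} (hφ : IntegrableOn φ S)
    (hφ0 : ∀ θ, φ θ ≤ 0) {z : ℂ} (hz : ‖z‖ < 1) :
    ‖Complex.exp (schwarzInt S φ z)‖ ≤ 1 := by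
  refine (norm_exp_schwarzInt_le hφ hφ0 hz).trans (Real.exp_le_one_iff.2 ?_)
  have := mul_nonneg (sub_nonneg.2 hz.le) (invSqInt_nonneg (S := S) hφ0 z)
  linarith

theorem IsOuter.norm_le_exp_invSqInt {f : ℂ → ℂ} (hf : IsOuter f)
    (hf1 : ∀ z ∈ closedBall (0 : ℂ) 1, ‖f z‖ ≤ 1) {S : Set ℝ} (hS : MeasurableSet S)
    (hS1 : S ⊆ Ico 0 (2 * Real.pi)) {z : ℂ} (hz : ‖z‖ < 1) :
    ‖f z‖ ≤ Real.exp (-((1 - ‖z‖) * invSqInt S (bdryLog f) z)) := by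
  have hφ := hf.integrableOn_bdryLog
  have hφ0 := bdryLog_nonpos hf1
  rw [hf.eq_exp_schwarzInt hz, ← schwarzInt_add_diff hS hS1 hφ hz, Complex.exp_add, norm_mul]
  exact (mul_le_of_le_one_right (norm_nonneg _)
    (norm_exp_schwarzInt_le_one (hφ.mono_set sdiff_subset) hφ0 hz)).trans
    (norm_exp_schwarzInt_le (hφ.mono_set hS1) hφ0 hz)

theorem IsOuter.norm_rpow_mul_norm_deriv_exp_schwarzInt_sq_le {f : ℂ → ℂ} (hf : IsOuter f)
    (hf1 : ∀ z ∈ closedBall (0 : ℂ) 1, ‖f z‖ ≤ 1) {S : Set ℝ} (hS : MeasurableSet S)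
    (hS1 : S ⊆ Ico 0 (2 * Real.pi)) {ρ : ℝ} (hρ : 1 ≤ ρ) {z : ℂ} (hz : ‖z‖ < 1) {Λ : Set ℝ}
    (hΛ : Λ = S ∨ Λ = Ico 0 (2 * Real.pi) \ S) :
    ‖f z‖ ^ (2 * ρ) * ‖deriv (fun w => Complex.exp (schwarzInt S (bdryLog f) w)) z‖ ^ 2 ≤
      2 * ‖deriv f z‖ ^ 2 + 8 * (‖f z‖ ^ (2 * ρ) * invSqInt Λ (bdryLog f) z ^ 2) := by
  have hφ := hf.integrableOn_bdryLog
  have hφ0 := bdryLog_nonpos hf1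
  have hφS := hφ.mono_set hS1
  have hφT := hφ.mono_set (sdiff_subset (s := Ico 0 (2 * Real.pi)) (t := S))
  have hdS := (hasDerivAt_schwarzInt hφS hz).differentiableAt
  have hdT := (hasDerivAt_schwarzInt hφT hz).differentiableAt
  have hle : ‖deriv (fun w => Complex.exp (schwarzInt S (bdryLog f) w)) z‖ ≤
      ‖deriv (schwarzInt S (bdryLog f)) z‖ := by
    rw [deriv_cexp hdS, norm_mul]
    exact mul_le_of_le_one_left (norm_nonneg _) (norm_exp_schwarzInt_le_one hφS hφ0 hz)
  rcases hΛ with rfl | rfl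
  · have h1 := hle.trans (norm_deriv_schwarzInt_le hφS hφ0 hz)
    have h2 : ‖deriv (fun w => Complex.exp (schwarzInt Λ (bdryLog f) w)) z‖ ^ 2 ≤
        4 * invSqInt Λ (bdryLog f) z ^ 2 := by
      refine (pow_le_pow_left₀ (norm_nonneg _) h1 2).trans (le_of_eq (by ring))
    have h3 : 0 ≤ ‖f z‖ ^ (2 * ρ) := by positivity
    nlinarith [mul_le_mul_of_nonneg_left h2 h3, sq_nonneg (‖deriv f z‖),
      mul_nonneg h3 (sq_nonneg (invSqInt Λ (bdryLog f) z))]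
  · have hfe : f =ᶠ[nhds z] fun w => Complex.exp (schwarzInt S (bdryLog f) w +
        schwarzInt (Ico 0 (2 * Real.pi) \ S) (bdryLog f) w) := by
      filter_upwards [isOpen_ball.mem_nhds (by simpa using hz : z ∈ ball (0 : ℂ) 1)] with w hw
      have hw1 : ‖w‖ < 1 := by simpa using hw
      rw [schwarzInt_add_diff hS hS1 hφ hw1, hf.eq_exp_schwarzInt hw1]
    have hder : deriv f z = f z * (deriv (schwarzInt S (bdryLog f)) z +
        deriv (schwarzInt (Ico 0 (2 * Real.pi) \ S) (bdryLog f)) z) := by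
      rw [hfe.deriv_eq, deriv_cexp (hdS.fun_add hdT), deriv_fun_add hdS hdT, ← hfe.eq_of_nhds]
    have h2 := norm_deriv_schwarzInt_le hφT hφ0 hz
    set u := deriv (schwarzInt S (bdryLog f)) z
    set v := deriv (schwarzInt (Ico 0 (2 * Real.pi) \ S) (bdryLog f)) z
    set a := invSqInt (Ico 0 (2 * Real.pi) \ S) (bdryLog f) z
    have h3 : ‖f z‖ * ‖u‖ ≤ ‖deriv f z‖ + ‖f z‖ * (2 * a) := by
      have : f z * u = deriv f z - f z * v := by rw [hder]; ring
      rw [← norm_mul, this]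
      refine (norm_sub_le _ _).trans ?_
      rw [norm_mul]
      gcongr
    have h4 : (‖f z‖ * ‖u‖) ^ 2 ≤ 2 * ‖deriv f z‖ ^ 2 + 8 * (‖f z‖ ^ 2 * a ^ 2) := by
      refine (pow_le_pow_left₀ (by positivity) h3 2).trans ?_
      nlinarith [sq_nonneg (‖deriv f z‖ - ‖f z‖ * (2 * a))]
    have h5 : ‖f z‖ ^ (2 * ρ) = ‖f z‖ ^ (2 * ρ - 2) * ‖f z‖ ^ 2 := by
      rw [← Real.rpow_natCast, ← Real.rpow_add_of_nonneg (norm_nonneg _) (by linarith)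
        (by norm_num)]
      norm_num
    have h6 : ‖f z‖ ^ (2 * ρ - 2) ≤ 1 :=
      Real.rpow_le_one (norm_nonneg _) (hf1 z (by simpa using hz.le)) (by linarith)
    calc _ ≤ ‖f z‖ ^ (2 * ρ) * ‖u‖ ^ 2 := by gcongr
      _ = ‖f z‖ ^ (2 * ρ - 2) * (‖f z‖ * ‖u‖) ^ 2 := by rw [h5]; ring
      _ ≤ ‖f z‖ ^ (2 * ρ - 2) * (2 * ‖deriv f z‖ ^ 2 + 8 * (‖f z‖ ^ 2 * a ^ 2)) := by gcongr
      _ = ‖f z‖ ^ (2 * ρ - 2) * (2 * ‖deriv f z‖ ^ 2) + 8 * (‖f z‖ ^ (2 * ρ) * a ^ 2) := by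
        rw [h5]; ring
      _ ≤ _ := add_le_add_left (mul_le_of_le_one_left (by positivity) h6) _

/-- Interpolation between a pointwise bound and an area bound for the derivative. -/
theorem norm_deriv_le_of_lintegral_le {f : ℂ → ℂ} (hf : DifferentiableOn ℂ f uDisc) {α ρ : ℝ}
    (hρ : 1 < ρ) (hα : ∀ z, ‖z‖ < 1 → ‖deriv f z‖ ≤ (1 - ‖z‖) ^ (α - 1)) {U : Set ℂ} {m : ℝ}
    (hm0 : 0 ≤ m)
    (hm : ∫⁻ z in uDisc ∩ U, ENNReal.ofReal (‖deriv f z‖ ^ 2) ≤ ENNReal.ofReal m)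
    {w : ℂ} (hw : ‖w‖ < 1) (hwU : ball w (1 - ‖w‖) ⊆ U) :
    ‖deriv f w‖ ≤ m ^ (1 / (2 * ρ)) * (1 - ‖w‖) ^ (α * (1 - 1 / ρ) - 1) := by
  set s := 1 - ‖w‖ with hs
  have hs0 : 0 < s := by linarith
  have hsub : ball w s ⊆ uDisc := fun x hx => by
    rw [mem_ball, dist_eq_norm] at hx
    rw [uDisc, mem_ball_zero_iff]
    linarith [norm_le_norm_add_norm_sub' x w]
  have h1 : Real.pi * s ^ 2 * ‖deriv f w‖ ^ 2 ≤ m := by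
    rw [← ENNReal.ofReal_le_ofReal_iff hm0]
    exact (area_mean_value hs0 ((hf.deriv isOpen_ball).mono hsub)).trans
      ((lintegral_mono_set (subset_inter hsub hwU)).trans hm)
  have h2 : ‖deriv f w‖ ≤ m ^ (1 / 2 : ℝ) / s := by
    rw [le_div_iff₀ hs0, ← Real.sqrt_eq_rpow]
    refine Real.le_sqrt_of_sq_le ?_
    nlinarith [Real.pi_gt_three, sq_nonneg (s * ‖deriv f w‖)]
  have hρ1 : 1 / ρ ≤ 1 := by rw [div_le_one (by linarith)]; exact hρ.le
  have hρ0 : 0 < 1 / ρ := by positivity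
  calc ‖deriv f w‖ = ‖deriv f w‖ ^ (1 - 1 / ρ) * ‖deriv f w‖ ^ (1 / ρ) := by
        rw [← Real.rpow_add_of_nonneg (norm_nonneg _) (by linarith) hρ0.le]
        simp
    _ ≤ (s ^ (α - 1)) ^ (1 - 1 / ρ) * (m ^ (1 / 2 : ℝ) / s) ^ (1 / ρ) := by
        have := hα w hw
        gcongr
    _ = m ^ (1 / (2 * ρ)) * (s ^ ((α - 1) * (1 - 1 / ρ)) * s ^ (-(1 / ρ))) := by
        rw [Real.div_rpow (by positivity) hs0.le, ← Real.rpow_mul hs0.le, ← Real.rpow_mul hm0,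
          Real.rpow_neg hs0.le, one_div_mul_one_div]
        ring
    _ = m ^ (1 / (2 * ρ)) * s ^ (α * (1 - 1 / ρ) - 1) := by
        rw [← Real.rpow_add hs0]
        ring_nf

theorem norm_one_sub_mul {p : ℂ} (hp : ‖p‖ = 1) {s : ℝ} (hs : s ≤ 1) :
    ‖((1 - s : ℝ) : ℂ) * p‖ = 1 - s := by
  rw [norm_mul, hp, mul_one, Complex.norm_real, Real.norm_of_nonneg (by linarith)]

theorem norm_radial_sub_le {f : ℂ → ℂ} (hf : IsDiscReg f) {p : ℂ} (hp : ‖p‖ = 1) {τ K R s : ℝ}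
    (hτ : 0 < τ) (hK : 0 ≤ K) (hs0 : 0 ≤ s) (hsR : s ≤ R) (hR : R ≤ 1)
    (hb : ∀ t, 0 < t → t ≤ R → ‖deriv f (((1 - t : ℝ) : ℂ) * p)‖ ≤ K * t ^ (τ - 1)) :
    ‖f (((1 - s : ℝ) : ℂ) * p) - f (((1 - R : ℝ) : ℂ) * p)‖ ≤ K * R ^ τ / τ := by
  rcases eq_or_lt_of_le (hs0.trans hsR) with h0 | hR0
  · obtain rfl : s = R := by linarith
    rw [sub_self, norm_zero]
    positivity
  set h : ℝ → ℂ := fun t => f (((1 - t : ℝ) : ℂ) * p) with hh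
  have hder : ∀ t, 0 < t → t ≤ 1 →
      HasDerivAt h (deriv f (((1 - t : ℝ) : ℂ) * p) * -p) t := fun t ht ht1 => by
    have hmem : ((1 - t : ℝ) : ℂ) * p ∈ uDisc := by
      rw [uDisc, mem_ball_zero_iff, norm_one_sub_mul hp ht1]
      linarith
    have h1 := (hf.1.differentiableAt (isOpen_ball.mem_nhds hmem)).hasDerivAt
    have h2 : HasDerivAt (fun t : ℝ => ((1 - t : ℝ) : ℂ) * p) (-p) t := by
      have := (((hasDerivAt_id' t).const_sub 1).ofReal_comp).mul_const p
      simpa using this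
    exact h1.comp t h2
  have hpos : ∀ t ∈ Ioc 0 R, ‖h t - h R‖ ≤ K * R ^ τ / τ := by
    intro t ht
    have hB : ∀ x, 0 < x → HasDerivAt (fun x => K * x ^ τ / τ - K * t ^ τ / τ)
        (K * x ^ (τ - 1)) x := fun x hx => by
      have := (((Real.hasDerivAt_rpow_const (p := τ) (Or.inl hx.ne')).const_mul K).div_const
        τ).sub_const (K * t ^ τ / τ)
      refine this.congr_deriv ?_
      field_simp
    have := image_norm_le_of_norm_deriv_right_le_deriv_boundary' (f := fun x => h x - h t)
      (a := t) (b := R) (f' := fun x => deriv f (((1 - x : ℝ) : ℂ) * p) * -p)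
      (B := fun x => K * x ^ τ / τ - K * t ^ τ / τ) (B' := fun x => K * x ^ (τ - 1))
      (fun x hx => ((hder x (ht.1.trans_le hx.1)
        (hx.2.trans hR)).continuousAt.continuousWithinAt.sub continuousWithinAt_const))
      (fun x hx => ((hder x (ht.1.trans_le hx.1)
        (hx.2.le.trans hR)).sub_const _).hasDerivWithinAt)
      (by simp)
      (fun x hx => (hB x (ht.1.trans_le hx.1)).continuousAt.continuousWithinAt)
      (fun x hx => (hB x (ht.1.trans_le hx.1)).hasDerivWithinAt)
      (fun x hx => by
        rw [norm_mul, norm_neg, hp, mul_one]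
        exact hb x (ht.1.trans_le hx.1) hx.2.le)
      (right_mem_Icc.2 ht.2)
    rw [norm_sub_rev]
    refine this.trans (sub_le_self _ ?_)
    have := ht.1
    positivity
  have hcl : closure (Ioc 0 R) = Icc 0 R := closure_Ioc hR0.ne
  refine le_on_closure hpos ?_ continuousOn_const (hcl ▸ ⟨hs0, hsR⟩ : s ∈ closure (Ioc 0 R))
  rw [hcl]
  refine ContinuousOn.norm (ContinuousOn.sub ?_ continuousOn_const)
  refine hf.2.comp (by fun_prop) fun t ht => ?_
  rw [mem_closedBall_zero_iff, norm_one_sub_mul hp (ht.2.trans hR)]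
  linarith [ht.1]

theorem ball_one_sub_norm_subset {z w : ℂ} {R : ℝ} (h : ‖w - z‖ + (1 - ‖w‖) ≤ R) :
    ball w (1 - ‖w‖) ⊆ ball z R :=
  ball_subset_ball' (by rw [dist_eq_norm]; linarith)

theorem norm_sub_radial_le_of_lintegral_le {f : ℂ → ℂ} (hf : IsDiscReg f) {α ρ : ℝ}
    (hα0 : 0 < α) (hρ : 1 < ρ) (hα : ∀ z, ‖z‖ < 1 → ‖deriv f z‖ ≤ (1 - ‖z‖) ^ (α - 1))
    {p z : ℂ} {δ R m : ℝ} (hp : ‖p‖ = 1) (hδ : 0 ≤ δ) (hδR : δ ≤ R)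
    (hR : R ≤ 1) (hm0 : 0 ≤ m)
    (hm : ∫⁻ w in uDisc ∩ ball z (10 * R), ENNReal.ofReal (‖deriv f w‖ ^ 2) ≤ ENNReal.ofReal m)
    (hz : ∀ s, 0 < s → s ≤ R → ‖((1 - s : ℝ) : ℂ) * p - z‖ ≤ 9 * R) :
    ‖f (((1 - δ : ℝ) : ℂ) * p) - f (((1 - R : ℝ) : ℂ) * p)‖ ≤
      m ^ (1 / (2 * ρ)) * R ^ (α * (1 - 1 / ρ)) / (α * (1 - 1 / ρ)) := by
  have hρ1 : 1 / ρ < 1 := by rw [div_lt_one (by linarith)]; exact hρ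
  refine norm_radial_sub_le hf hp (mul_pos hα0 (by linarith)) (by positivity) hδ hδR hR
    fun t ht htR => ?_
  have hn := norm_one_sub_mul hp (htR.trans hR)
  have := norm_deriv_le_of_lintegral_le hf.1 hρ hα hm0 hm (w := ((1 - t : ℝ) : ℂ) * p)
    (by rw [hn]; linarith) (ball_one_sub_norm_subset (by rw [hn]; linarith [hz t ht htR]))
  rwa [hn, sub_sub_cancel] at this

theorem norm_sub_horizontal_le_of_lintegral_le {f : ℂ → ℂ} (hf : DifferentiableOn ℂ f uDisc)
    {α ρ : ℝ} (hα0 : 0 < α) (hα1 : α ≤ 1) (hρ : 1 < ρ)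
    (hα : ∀ z, ‖z‖ < 1 → ‖deriv f z‖ ≤ (1 - ‖z‖) ^ (α - 1))
    {ζ p z : ℂ} {R m : ℝ} (hζ : ‖ζ‖ = 1) (hp : ‖p‖ = 1) (hR0 : 0 < R)
    (hR : R ≤ 1) (hpζ : ‖p - ζ‖ ≤ 4 * R) (hm0 : 0 ≤ m)
    (hm : ∫⁻ w in uDisc ∩ ball z (10 * R), ENNReal.ofReal (‖deriv f w‖ ^ 2) ≤ ENNReal.ofReal m)
    (hz : ‖((1 - R : ℝ) : ℂ) * ζ - z‖ ≤ R) :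
    ‖f (((1 - R : ℝ) : ℂ) * ζ) - f (((1 - R : ℝ) : ℂ) * p)‖ ≤
      m ^ (1 / (2 * ρ)) * R ^ (α * (1 - 1 / ρ)) * 4 := by
  have hρ0 : 0 < 1 / ρ := by positivity
  have hnζ := norm_one_sub_mul hζ hR
  have hnp := norm_one_sub_mul hp hR
  set x := ((1 - R : ℝ) : ℂ) * ζ with hx
  set y := ((1 - R : ℝ) : ℂ) * p with hy
  have hxy : ‖x - y‖ ≤ 4 * R := by
    rw [hx, hy, ← mul_sub, norm_mul, Complex.norm_real, Real.norm_of_nonneg (by linarith),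
      norm_sub_rev]
    nlinarith [norm_nonneg (p - ζ)]
  have hconv : Convex ℝ (closedBall (0 : ℂ) (1 - R) ∩ closedBall x (4 * R)) :=
    (convex_closedBall _ _).inter (convex_closedBall _ _)
  have hbound := hconv.norm_image_sub_le_of_norm_deriv_le (𝕜 := ℂ) (f := f) (x := y) (y := x)
    (C := m ^ (1 / (2 * ρ)) * R ^ (α * (1 - 1 / ρ) - 1)) ?_ ?_ ?_ ?_
  · refine hbound.trans ((mul_le_mul_of_nonneg_left hxy (by positivity)).trans (le_of_eq ?_))
    rw [Real.rpow_sub_one hR0.ne']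
    field_simp
  · intro w hw
    have hw1 : ‖w‖ ≤ 1 - R := mem_closedBall_zero_iff.1 hw.1
    refine hf.differentiableAt (isOpen_ball.mem_nhds ?_)
    rw [mem_ball_zero_iff]
    linarith
  · intro w hw
    have hw1 : ‖w‖ ≤ 1 - R := mem_closedBall_zero_iff.1 hw.1
    have hw2 : ‖w - x‖ ≤ 4 * R := by simpa [dist_eq_norm] using hw.2
    have h1 : 1 - R - 4 * R ≤ ‖w‖ := by
      rw [← hnζ]
      linarith [norm_le_norm_add_norm_sub w x]
    have h2 : ‖w - z‖ ≤ 4 * R + R := (norm_sub_le_norm_sub_add_norm_sub w x z).trans (by linarith)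
    refine (norm_deriv_le_of_lintegral_le hf hρ hα hm0 hm (by linarith)
      (ball_one_sub_norm_subset (by linarith))).trans ?_
    refine mul_le_mul_of_nonneg_left ?_ (by positivity)
    refine Real.rpow_le_rpow_of_nonpos hR0 (by linarith) ?_
    nlinarith
  · exact ⟨by rw [mem_closedBall_zero_iff, hnp], by
      rw [mem_closedBall, dist_eq_norm, norm_sub_rev]; exact hxy⟩
  · exact ⟨by rw [mem_closedBall_zero_iff, hnζ], mem_closedBall_self (by linarith)⟩

theorem norm_one_sub_mul_sub {p : ℂ} (hp : ‖p‖ = 1) (s t : ℝ) :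
    ‖((1 - s : ℝ) : ℂ) * p - ((1 - t : ℝ) : ℂ) * p‖ = |t - s| := by
  rw [← sub_mul, norm_mul, hp, mul_one, ← Complex.ofReal_sub, Complex.norm_real, Real.norm_eq_abs]
  ring_nf

theorem norm_sub_radial_self_le {f : ℂ → ℂ} (hf : IsDiscReg f) {α ρ : ℝ}
    (hα0 : 0 < α) (hρ : 1 < ρ) (hα : ∀ z, ‖z‖ < 1 → ‖deriv f z‖ ≤ (1 - ‖z‖) ^ (α - 1))
    {ζ : ℂ} {δ R m : ℝ} (hζ : ‖ζ‖ = 1) (hδ : 0 ≤ δ) (hδR : δ ≤ R)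
    (hR : R ≤ 1) (hm0 : 0 ≤ m)
    (hm : ∫⁻ w in uDisc ∩ ball (((1 - δ : ℝ) : ℂ) * ζ) (10 * R),
      ENNReal.ofReal (‖deriv f w‖ ^ 2) ≤ ENNReal.ofReal m) :
    ‖f (((1 - δ : ℝ) : ℂ) * ζ) - f (((1 - R : ℝ) : ℂ) * ζ)‖ ≤
      m ^ (1 / (2 * ρ)) * R ^ (α * (1 - 1 / ρ)) / (α * (1 - 1 / ρ)) := by
  refine norm_sub_radial_le_of_lintegral_le hf hα0 hρ hα hζ hδ hδR hR hm0 hm fun s hs hsR => ?_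
  rw [norm_one_sub_mul_sub hζ, abs_le]
  constructor <;> linarith

theorem norm_le_of_boundary_zero {f : ℂ → ℂ} (hf : IsDiscReg f) {α ρ : ℝ}
    (hα0 : 0 < α) (hα1 : α ≤ 1) (hρ : 1 < ρ)
    (hα : ∀ z, ‖z‖ < 1 → ‖deriv f z‖ ≤ (1 - ‖z‖) ^ (α - 1))
    {ζ p : ℂ} {δ R m : ℝ} (hζ : ‖ζ‖ = 1) (hp : ‖p‖ = 1) (hfp : f p = 0) (hδ : 0 ≤ δ) (hR0 : 0 < R)
    (hδR : δ ≤ R) (hR : R ≤ 1) (hpζ : ‖p - ζ‖ ≤ 4 * R) (hm0 : 0 ≤ m)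
    (hm : ∫⁻ w in uDisc ∩ ball (((1 - δ : ℝ) : ℂ) * ζ) (10 * R),
      ENNReal.ofReal (‖deriv f w‖ ^ 2) ≤ ENNReal.ofReal m) :
    ‖f (((1 - δ : ℝ) : ℂ) * ζ)‖ ≤
      m ^ (1 / (2 * ρ)) * R ^ (α * (1 - 1 / ρ)) * (2 / (α * (1 - 1 / ρ)) + 4) := by
  have h1 := norm_sub_radial_self_le hf hα0 hρ hα hζ hδ hδR hR hm0 hm
  have h2 := norm_sub_horizontal_le_of_lintegral_le hf.1 hα0 hα1 hρ hα hζ hp hR0 hR hpζ hm0 hm (by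
    rw [norm_one_sub_mul_sub hζ, abs_le]
    constructor <;> linarith)
  have h3 := norm_sub_radial_le_of_lintegral_le (δ := 0) hf hα0 hρ hα hp le_rfl hR0.le hR hm0 hm
    fun s hs hsR => by
      refine (norm_sub_le_norm_sub_add_norm_sub _ (((1 - s : ℝ) : ℂ) * ζ) _).trans ?_
      have h4 : |δ - s| ≤ R := by
        rw [abs_le]
        constructor <;> linarith
      rw [norm_one_sub_mul_sub hζ, ← mul_sub, norm_mul, Complex.norm_real,
        Real.norm_of_nonneg (by linarith)]
      nlinarith [norm_nonneg (p - ζ)]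
  rw [sub_zero, Complex.ofReal_one, one_mul, hfp, zero_sub, norm_neg] at h3
  set x := f (((1 - δ : ℝ) : ℂ) * ζ)
  set y := f (((1 - R : ℝ) : ℂ) * ζ)
  set w := f (((1 - R : ℝ) : ℂ) * p)
  have : ‖x‖ ≤ ‖x - y‖ + ‖y - w‖ + ‖w‖ := by
    calc ‖x‖ = ‖(x - y) + (y - w) + w‖ := by congr 1; ring
      _ ≤ _ := norm_add₃_le
  refine (this.trans (add_le_add (add_le_add h1 h2) h3)).trans (le_of_eq ?_)
  ring

theorem rpow_two_mul_le_of_le {α ρ m R x c : ℝ} (hρ1 : 1 < ρ) (hρ2 : ρ ≤ 2) (hm : 0 ≤ m)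
    (hR : 0 ≤ R) (hx : 0 ≤ x) (hc : 1 ≤ c)
    (h : x ≤ m ^ (1 / (2 * ρ)) * R ^ (α * (1 - 1 / ρ)) * c) :
    x ^ (2 * ρ) ≤ c ^ 4 * (m * R ^ (2 * α * (ρ - 1))) := by
  calc x ^ (2 * ρ) ≤ (m ^ (1 / (2 * ρ)) * R ^ (α * (1 - 1 / ρ)) * c) ^ (2 * ρ) := by gcongr
    _ = m * R ^ (2 * α * (ρ - 1)) * c ^ (2 * ρ) := by
        rw [Real.mul_rpow (by positivity) (by positivity), Real.mul_rpow (by positivity)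
          (by positivity), ← Real.rpow_mul hm, ← Real.rpow_mul hR]
        congr 2
        · rw [one_div_mul_cancel (by positivity), Real.rpow_one]
        · congr 1
          field_simp
    _ ≤ m * R ^ (2 * α * (ρ - 1)) * c ^ 4 := by
        gcongr
        rw [← Real.rpow_natCast]
        exact Real.rpow_le_rpow_of_exponent_le hc (by push_cast; linarith)
    _ = _ := by ring

theorem exists_exp_neg_rpow_mul_le {k : ℝ} (hk : 0 < k) :
    ∃ C : ℝ, 0 < C ∧ ∀ a, 1 ≤ a → Real.exp (-(a ^ k / 4)) * a ≤ C := by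
  obtain ⟨n, hn⟩ := exists_nat_ge (1 / k)
  refine ⟨4 ^ n * n.factorial, by positivity, fun a ha => ?_⟩
  have h1 := Real.pow_div_factorial_le_exp (a ^ k / 4) (by positivity) n
  have h2 : a ≤ (a ^ k) ^ n := by
    rw [← Real.rpow_natCast, ← Real.rpow_mul (by positivity)]
    refine Real.self_le_rpow_of_one_le ha ?_
    rwa [div_le_iff₀' hk] at hn
  rw [Real.exp_neg, inv_mul_le_iff₀ (Real.exp_pos _)]
  calc a ≤ (a ^ k) ^ n := h2
    _ = (a ^ k / 4) ^ n / n.factorial * (4 ^ n * n.factorial) := by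
      rw [div_pow]
      field_simp
    _ ≤ _ := by gcongr

theorem add_rpow_two_mul_le {ρ x y : ℝ} (hρ1 : 1 ≤ ρ) (hρ2 : ρ ≤ 2) (hx : 0 ≤ x) (hy : 0 ≤ y) :
    (x + y) ^ (2 * ρ) ≤ 16 * (x ^ (2 * ρ) + y ^ (2 * ρ)) := by
  have key : ∀ u : ℝ, 0 ≤ u → (2 * u) ^ (2 * ρ) ≤ 16 * u ^ (2 * ρ) := fun u hu => by
    rw [Real.mul_rpow (by norm_num) hu]
    gcongr
    calc (2 : ℝ) ^ (2 * ρ) ≤ 2 ^ (4 : ℝ) :=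
          Real.rpow_le_rpow_of_exponent_le (by norm_num) (by linarith)
      _ = 16 := by norm_num
  have hx' : 0 ≤ x ^ (2 * ρ) := by positivity
  have hy' : 0 ≤ y ^ (2 * ρ) := by positivity
  rcases le_total x y with h | h
  · calc (x + y) ^ (2 * ρ) ≤ (2 * y) ^ (2 * ρ) := by gcongr; linarith
      _ ≤ _ := (key y hy).trans (by linarith)
  · calc (x + y) ^ (2 * ρ) ≤ (2 * x) ^ (2 * ρ) := by gcongr; linarith
      _ ≤ _ := (key x hx).trans (by linarith)

theorem rpow_two_mul_mul_sq_le {ρ x a k C : ℝ} (hρ : 1 ≤ ρ) (hx0 : 0 ≤ x) (ha : 0 ≤ a)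
    (hx : x ≤ Real.exp (-(a ^ k / 4))) (hC : Real.exp (-(a ^ k / 4)) * a ≤ C) :
    x ^ (2 * ρ) * a ^ 2 ≤ C ^ 2 := by
  have hx1 : x ≤ 1 := hx.trans (Real.exp_le_one_iff.2 (by
    have : 0 ≤ a ^ k := by positivity
    linarith))
  have h1 : x ^ (2 * ρ) ≤ x ^ 2 := by
    rw [← Real.rpow_natCast]
    exact Real.rpow_le_rpow_of_exponent_ge' hx0 hx1 (by norm_num) (by push_cast; linarith)
  calc x ^ (2 * ρ) * a ^ 2 ≤ x ^ 2 * a ^ 2 := by gcongr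
    _ = (x * a) ^ 2 := by ring
    _ ≤ C ^ 2 := by
      have := mul_le_mul_of_nonneg_right hx ha
      gcongr
      linarith

/-- The local mass of `‖f'‖²` at scale `10 R`. -/
noncomputable def derivMass (f : ℂ → ℂ) (z : ℂ) (R : ℝ) : ℝ :=
  (∫⁻ w in uDisc ∩ ball z (10 * R), ENNReal.ofReal (‖deriv f w‖ ^ 2)).toReal

theorem ofReal_derivMass {f : ℂ → ℂ}
    (hD : ∫⁻ z in uDisc, ENNReal.ofReal (‖deriv f z‖ ^ 2) ≤ ENNReal.ofReal Real.pi)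
    (z : ℂ) (R : ℝ) : ENNReal.ofReal (derivMass f z R) =
      ∫⁻ w in uDisc ∩ ball z (10 * R), ENNReal.ofReal (‖deriv f w‖ ^ 2) :=
  ENNReal.ofReal_toReal (((lintegral_mono_set inter_subset_left).trans hD).trans_lt
    ENNReal.ofReal_lt_top).ne

theorem exists_eq_one_sub_mul {z : ℂ} (hz : ‖z‖ < 1) :
    ∃ ζ : ℂ, ‖ζ‖ = 1 ∧ z = ((1 - (1 - ‖z‖) : ℝ) : ℂ) * ζ := by
  rcases eq_or_ne z 0 with rfl | h
  · exact ⟨1, by simp, by simp⟩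
  · refine ⟨(‖z‖ : ℂ)⁻¹ * z, ?_, ?_⟩
    · simp [h]
    · have : (‖z‖ : ℂ) ≠ 0 := by simpa using h
      rw [sub_sub_cancel, mul_inv_cancel_left₀ this]

theorem exists_norm_rpow_mul_invSqInt_sq_le {α ρ : ℝ} (hα0 : 0 < α) (hα1 : α ≤ 1) (hρ1 : 1 < ρ)
    (hρ2 : ρ ≤ 2) :
    ∃ C : ℝ, 0 < C ∧ ∀ f : ℂ → ℂ, IsOuter f → (∀ z ∈ closedBall (0 : ℂ) 1, ‖f z‖ ≤ 1) →
      (∀ z, ‖z‖ < 1 → ‖deriv f z‖ ≤ (1 - ‖z‖) ^ (α - 1)) →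
      ∫⁻ z in uDisc, ENNReal.ofReal (‖deriv f z‖ ^ 2) ≤ ENNReal.ofReal Real.pi →
      ∀ Γ, IsArcUnion f Γ → ∀ z, ‖z‖ < 1 →
        ∃ Λ, (Λ = angSet Γ ∨ Λ = Ico 0 (2 * Real.pi) \ angSet Γ) ∧ ∃ R, 0 < R ∧
          ‖f z‖ ^ (2 * ρ) * invSqInt Λ (bdryLog f) z ^ 2 ≤
            C * (1 + derivMass f z R * R ^ (-(2 - α * (ρ - 1)))) := by
  set β := 2 * α * (ρ - 1) with hβ
  have hβ0 : 0 < β := by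
    have : 0 < ρ - 1 := by linarith
    positivity
  set ε := β / 4 with hε
  have hε0 : 0 < ε := by positivity
  set k := ε / (1 + ε) with hk
  have hk0 : 0 < k := by positivity
  obtain ⟨E, hE0, hE⟩ := exists_exp_neg_rpow_mul_le hk0
  set τ := α * (1 - 1 / ρ) with hτ
  have hτ0 : 0 < τ := by
    have : 1 / ρ < 1 := by rw [div_lt_one (by linarith)]; exact hρ1
    exact mul_pos hα0 (by linarith)
  set c := 2 / τ + 4 with hc
  have hc1 : 1 ≤ c := by
    have : 0 < 2 / τ := by positivity
    linarith
  refine ⟨16 * (1 + E ^ 2 + c ^ 4), by positivity, fun f hf hf1 hα hD Γ hΓ z hz => ?_⟩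
  obtain ⟨ζ, hζ, hzζ⟩ := exists_eq_one_sub_mul hz
  have hS := hΓ.measurableSet_angSet hf.1.2
  have hS1 : angSet Γ ⊆ Ico 0 (2 * Real.pi) := fun θ hθ => hθ.1
  obtain ⟨Λ, hΛ, hΛΓ⟩ : ∃ Λ, (Λ = angSet Γ ∨ Λ = Ico 0 (2 * Real.pi) \ angSet Γ) ∧
      ∀ θ ∈ Λ, ¬ (Complex.exp ((θ : ℂ) * I) ∈ Γ ↔ ζ ∈ Γ) := by
    by_cases h : ζ ∈ Γ
    · exact ⟨_, Or.inr rfl, fun θ hθ hiff => hθ.2 ⟨hθ.1, hiff.2 h⟩⟩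
    · exact ⟨_, Or.inl rfl, fun θ hθ hiff => h (hiff.1 hθ.2)⟩
  have hΛm : MeasurableSet Λ := by
    rcases hΛ with rfl | rfl
    exacts [hS, measurableSet_Ico.diff hS]
  have hΛ1 : Λ ⊆ Ico 0 (2 * Real.pi) := by
    rcases hΛ with rfl | rfl
    exacts [hS1, sdiff_subset]
  refine ⟨Λ, hΛ, ?_⟩
  have hφ0 := bdryLog_nonpos hf1
  set a := invSqInt Λ (bdryLog f) z with ha
  have ha0 : 0 ≤ a := invSqInt_nonneg hφ0 z
  have hfz1 : ‖f z‖ ≤ 1 := hf1 z (by simpa using hz.le)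
  have hP1 : ‖f z‖ ^ (2 * ρ) ≤ 1 := Real.rpow_le_one (norm_nonneg _) hfz1 (by linarith)
  have hP0 : 0 ≤ ‖f z‖ ^ (2 * ρ) := by positivity
  set δ := 1 - ‖z‖ with hδ
  have hδ0 : 0 < δ := by linarith
  have hm0 : ∀ R, 0 ≤ derivMass f z R := fun R => ENNReal.toReal_nonneg
  have hE2 := sq_nonneg E
  have hc4 : 0 ≤ c ^ 4 := by positivity
  rcases le_or_gt a 1 with ha1 | ha1
  · refine ⟨1, one_pos, ?_⟩
    rw [Real.one_rpow, mul_one]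
    have h1 : ‖f z‖ ^ (2 * ρ) * a ^ 2 ≤ 1 := mul_le_one₀ hP1 (by positivity) (by nlinarith)
    nlinarith [hm0 1, mul_nonneg hE2 (hm0 1), mul_nonneg hc4 (hm0 1)]
  set R := a ^ (-(1 / (1 + ε))) with hR
  have hR0 : 0 < R := by positivity
  have hR1 : R < 1 := Real.rpow_lt_one_of_one_lt_of_neg ha1 (by
    have : 0 < 1 / (1 + ε) := by positivity
    linarith)
  have hRa : R * a = a ^ k := by
    rw [hR, ← Real.rpow_add_one (by positivity), hk]
    congr 1
    field_simp
    ring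
  have haR : a ^ 2 * R ^ β = R ^ (-(2 - α * (ρ - 1))) := by
    rw [hR, ← Real.rpow_natCast, ← Real.rpow_mul ha0, ← Real.rpow_mul ha0,
      ← Real.rpow_add (by positivity)]
    congr 1
    have h1 : β = 4 * ε := by rw [hε]; ring
    have h2 : α * (ρ - 1) = 2 * ε := by rw [hε, hβ]; ring
    rw [h1, h2]
    field_simp
    push_cast
    ring
  refine ⟨R, hR0, ?_⟩
  set m := derivMass f z R with hm
  have hm' := (ofReal_derivMass hD z R).ge
  set Q := R ^ (-(2 - α * (ρ - 1))) with hQ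
  have hmQ : 0 ≤ m * Q := mul_nonneg (hm0 R) (by positivity)
  have hmQE := mul_nonneg hE2 hmQ
  have hmQc := mul_nonneg hc4 hmQ
  have hexp : ∀ x, 0 ≤ x → x ≤ Real.exp (-(a ^ k / 4)) → x ^ (2 * ρ) * a ^ 2 ≤ E ^ 2 :=
    fun x hx0 hx => rpow_two_mul_mul_sq_le hρ1.le hx0 ha0 hx (hE a ha1.le)
  have hosc : ∀ x, 0 ≤ x → x ≤ m ^ (1 / (2 * ρ)) * R ^ τ * c →
      x ^ (2 * ρ) * a ^ 2 ≤ c ^ 4 * (m * Q) := fun x hx0 hx => by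
    have h1 := rpow_two_mul_le_of_le hρ1 hρ2 (hm0 R) hR0.le hx0 hc1 hx
    calc x ^ (2 * ρ) * a ^ 2 ≤ c ^ 4 * (m * R ^ β) * a ^ 2 := by gcongr
      _ = c ^ 4 * (m * (a ^ 2 * R ^ β)) := by ring
      _ = _ := by rw [haR]
  rcases lt_or_ge R δ with hRδ | hRδ
  · have h1 := hf.norm_le_exp_invSqInt hf1 hΛm hΛ1 hz
    have h2 := hexp _ (norm_nonneg _) (h1.trans (Real.exp_le_exp.2 (by
      rw [← hRa]
      nlinarith [mul_pos hR0 (zero_lt_one.trans ha1)])))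
    linarith
  have hm'' : ∫⁻ w in uDisc ∩ ball (((1 - δ : ℝ) : ℂ) * ζ) (10 * R),
      ENNReal.ofReal (‖deriv f w‖ ^ 2) ≤ ENNReal.ofReal m := by rwa [← hzζ]
  by_cases hex : ∃ p ∈ bZeros f, ‖p - ζ‖ ≤ 4 * R
  · obtain ⟨p, hp, hpζ⟩ := hex
    have h1 := norm_le_of_boundary_zero hf.1 hα0 hα1 hρ1 hα hζ (by simpa [uCircle] using hp.1) hp.2
      hδ0.le hR0 hRδ hR1.le hpζ (hm0 R) hm''
    rw [← hzζ] at h1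
    have h2 := hosc _ (norm_nonneg _) h1
    linarith
  · push Not at hex
    set w := ((1 - R : ℝ) : ℂ) * ζ with hw
    have hwn : ‖w‖ = 1 - R := norm_one_sub_mul hζ hR1.le
    have hzw : ‖z - w‖ = R - δ := by
      rw [hzζ, hw, norm_one_sub_mul_sub hζ, abs_of_nonneg (by linarith)]
    have hζz : ‖ζ - z‖ = δ := by
      have : ζ = ((1 - 0 : ℝ) : ℂ) * ζ := by simp
      rw [hzζ]
      nth_rw 1 [this]
      rw [norm_one_sub_mul_sub hζ, sub_zero, abs_of_pos hδ0]
    have h1 : a ≤ 4 * invSqInt Λ (bdryLog f) w := by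
      refine invSqInt_le_four_mul hΛm (hf.integrableOn_bdryLog.mono_set hΛ1) hφ0 hz
        (by linarith) fun θ hθ => ?_
      have h2 : 2 * R ≤ ‖Complex.exp ((θ : ℂ) * I) - ζ‖ := by
        by_contra! hlt
        exact hΛΓ θ hθ (hΓ.mem_iff_of_norm_sub_lt hζ (Complex.norm_exp_ofReal_mul_I θ)
          (fun p hp => (hex p hp).le) hlt)
      have h3 := norm_sub_le_norm_sub_add_norm_sub (Complex.exp ((θ : ℂ) * I)) z ζ
      have h4 := norm_sub_le_norm_sub_add_norm_sub (Complex.exp ((θ : ℂ) * I)) z w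
      rw [norm_sub_rev z ζ] at h3
      linarith
    have h2 := hf.norm_le_exp_invSqInt hf1 hΛm hΛ1 (z := w) (by linarith)
    rw [hwn, sub_sub_cancel] at h2
    have h3 := hexp _ (norm_nonneg _) (h2.trans (Real.exp_le_exp.2 (by
      rw [← hRa]
      nlinarith)))
    have h4 := norm_sub_radial_self_le hf.1 hα0 hρ1 hα hζ hδ0.le hRδ hR1.le (hm0 R) hm''
    rw [← hzζ] at h4
    have hτc : 1 / τ ≤ c := by
      have h1 : 0 < 1 / τ := by positivity
      have h2 : 2 / τ = 2 * (1 / τ) := by ring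
      rw [hc, h2]
      linarith
    have h5 := hosc _ (norm_nonneg _) (h4.trans ((div_eq_mul_one_div _ _).le.trans
      (mul_le_mul_of_nonneg_left hτc (mul_nonneg (Real.rpow_nonneg (hm0 R) _) (by positivity)))))
    have h6 : ‖f z‖ ^ (2 * ρ) ≤ 16 * (‖f z - f w‖ ^ (2 * ρ) + ‖f w‖ ^ (2 * ρ)) := by
      refine le_trans ?_ (add_rpow_two_mul_le hρ1.le hρ2 (norm_nonneg _) (norm_nonneg _))
      gcongr
      simpa using norm_add_le (f z - f w) (f w)
    calc ‖f z‖ ^ (2 * ρ) * a ^ 2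
        ≤ 16 * (‖f z - f w‖ ^ (2 * ρ) + ‖f w‖ ^ (2 * ρ)) * a ^ 2 := by gcongr
      _ = 16 * (‖f z - f w‖ ^ (2 * ρ) * a ^ 2 + ‖f w‖ ^ (2 * ρ) * a ^ 2) := by ring
      _ ≤ 16 * (c ^ 4 * (m * Q) + E ^ 2) := by gcongr
      _ ≤ _ := by linarith

theorem ofReal_derivMass_mul_rpow_le {f : ℂ → ℂ}
    (hD : ∫⁻ z in uDisc, ENNReal.ofReal (‖deriv f z‖ ^ 2) ≤ ENNReal.ofReal Real.pi)
    (z : ℂ) {R s : ℝ} (hR : 0 < R) (hs : 0 ≤ s) :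
    ENNReal.ofReal (derivMass f z R * R ^ (-s)) ≤ ENNReal.ofReal (10 ^ s) *
      ∫⁻ w in uDisc, ENNReal.ofReal (‖deriv f w‖ ^ 2) * ENNReal.ofReal (‖w - z‖ ^ (-s)) := by
  rw [ENNReal.ofReal_mul (show 0 ≤ derivMass f z R from ENNReal.toReal_nonneg),
    ofReal_derivMass hD,
    ← lintegral_mul_const' _ _ ENNReal.ofReal_ne_top,
    ← lintegral_const_mul' _ _ ENNReal.ofReal_ne_top]
  refine le_trans ?_ (lintegral_mono_set (inter_subset_left (t := ball z (10 * R))))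
  refine lintegral_mono_ae ?_
  have hne : ∀ᵐ w ∂(volume.restrict (uDisc ∩ ball z (10 * R))), w ≠ z :=
    ae_restrict_of_ae (Measure.ae_ne volume z)
  filter_upwards [hne,
    ae_restrict_mem (measurableSet_ball.inter measurableSet_ball)] with w hw hwm
  have h0 : 0 < ‖w - z‖ := norm_pos_iff.2 (sub_ne_zero.2 hw)
  have h1 : ‖w - z‖ ≤ 10 * R := by
    have := hwm.2
    rw [mem_ball, dist_eq_norm] at this
    exact this.le
  rw [mul_left_comm, ← ENNReal.ofReal_mul (by positivity : (0 : ℝ) ≤ 10 ^ s)]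
  gcongr
  calc R ^ (-s) = 10 ^ s * (10 * R) ^ (-s) := by
        rw [Real.mul_rpow (by norm_num) hR.le, ← mul_assoc, ← Real.rpow_add (by norm_num),
          add_neg_cancel, Real.rpow_zero, one_mul]
    _ ≤ 10 ^ s * ‖w - z‖ ^ (-s) := by
        refine mul_le_mul_of_nonneg_left ?_ (by positivity)
        exact Real.rpow_le_rpow_of_nonpos h0 h1 (by linarith)

theorem lintegral_potential_le {g : ℂ → ℝ≥0∞} (hg : Measurable g) {s C : ℝ}
    (hC : ∀ w ∈ uDisc, ∫⁻ z in uDisc, ENNReal.ofReal (‖w - z‖ ^ (-s)) ≤ ENNReal.ofReal C) :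
    ∫⁻ z in uDisc, ∫⁻ w in uDisc, g w * ENNReal.ofReal (‖w - z‖ ^ (-s)) ≤
      (∫⁻ w in uDisc, g w) * ENNReal.ofReal C := by
  rw [lintegral_lintegral_swap (Measurable.aemeasurable (by fun_prop)),
    ← lintegral_mul_const' _ _ ENNReal.ofReal_ne_top]
  refine setLIntegral_mono' measurableSet_ball fun w hw => ?_
  rw [lintegral_const_mul _ (by fun_prop)]
  gcongr
  exact hC w hw

/-- `∫_𝔻 |f|^{2ρ} |f_Γ'|² dA ≤ C_ρ`, uniformly over all unions `Γ`
of component arcs of `𝕋 \ E_f`. -/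
theorem global_outer_part_deriv_est (α ρ : ℝ) (hα0 : 0 < α) (hα1 : α ≤ 1/2)
    (hρ1 : 1 < ρ) (hρ2 : ρ ≤ 2) :
    ∃ C : ℝ, 0 < C ∧ ∀ f : ℂ → ℂ, MemA α f → IsOuter f → ANorm α f ≤ 1 →
      (∀ γ, IsCompArc f γ → volume (angSet γ) < ENNReal.ofReal (1/2)) →
      ∀ Γ : Set ℂ, IsArcUnion f Γ →
        nlint uDisc (fun z => ‖f z‖ ^ (2 * ρ) * ‖deriv (outerPart f Γ) z‖ ^ 2) ≤
          ENNReal.ofReal C := by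
  obtain ⟨C₁, hC₁, hpt⟩ := exists_norm_rpow_mul_invSqInt_sq_le hα0 (by linarith) hρ1 hρ2
  have hαρ : 0 < α * (ρ - 1) := mul_pos hα0 (by linarith)
  have hαρ2 : α * (ρ - 1) ≤ 2 := by nlinarith
  obtain ⟨C₂, hC₂, hker⟩ :=
    exists_lintegral_norm_sub_rpow_le (s := 2 - α * (ρ - 1)) (by linarith)
  set s := 2 - α * (ρ - 1)
  have hs : 0 ≤ s := sub_nonneg.2 hαρ2
  refine ⟨2 + 8 * C₁ * (1 + 10 ^ s * C₂), by positivity, fun f hfA hf hN _ Γ hΓ => ?_⟩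
  obtain ⟨hf1, hα, hD⟩ := hfA.norm_bounds (by linarith) hN
  set g : ℂ → ℝ≥0∞ := fun w => ENNReal.ofReal (‖deriv f w‖ ^ 2) with hg
  have hgm : Measurable g := ((measurable_deriv f).norm.pow_const 2).ennreal_ofReal
  set P : ℂ → ℝ≥0∞ := fun z => ∫⁻ w in uDisc, g w * ENNReal.ofReal (‖w - z‖ ^ (-s)) with hP
  have hbound : ∀ z ∈ uDisc,
      ENNReal.ofReal (‖f z‖ ^ (2 * ρ) * ‖deriv (outerPart f Γ) z‖ ^ 2) ≤
        ENNReal.ofReal 2 * g z + ENNReal.ofReal (8 * C₁) * (1 + ENNReal.ofReal (10 ^ s) * P z) := by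
    intro z hz
    have hz1 : ‖z‖ < 1 := by simpa [uDisc] using hz
    obtain ⟨Λ, hΛ, R, hR, hle⟩ := hpt f hf hf1 hα hD Γ hΓ z hz1
    have h1 := hf.norm_rpow_mul_norm_deriv_exp_schwarzInt_sq_le hf1
      (hΓ.measurableSet_angSet hf.1.2) (fun θ hθ => hθ.1) hρ1.le hz1 hΛ
    have hm : 0 ≤ derivMass f z R * R ^ (-s) :=
      mul_nonneg ENNReal.toReal_nonneg (by positivity)
    calc ENNReal.ofReal (‖f z‖ ^ (2 * ρ) * ‖deriv (outerPart f Γ) z‖ ^ 2)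
        ≤ ENNReal.ofReal (2 * ‖deriv f z‖ ^ 2 + 8 * C₁ * (1 + derivMass f z R * R ^ (-s))) :=
          ENNReal.ofReal_le_ofReal (h1.trans (by linarith))
      _ = ENNReal.ofReal 2 * g z +
          ENNReal.ofReal (8 * C₁) * (1 + ENNReal.ofReal (derivMass f z R * R ^ (-s))) := by
          rw [ENNReal.ofReal_add (by positivity) (by positivity), ENNReal.ofReal_mul (by norm_num),
            ENNReal.ofReal_mul (by positivity : 0 ≤ 8 * C₁), ENNReal.ofReal_add zero_le_one hm,
            ENNReal.ofReal_one]
      _ ≤ _ := by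
          gcongr
          exact ofReal_derivMass_mul_rpow_le hD z hR hs
  have hvol : volume uDisc = ENNReal.ofReal Real.pi := by
    simp [uDisc, ENNReal.ofReal, Real.toNNReal_of_nonneg Real.pi_pos.le, NNReal.pi]
    rfl
  have hPint : ∫⁻ z in uDisc, P z ≤ ENNReal.ofReal (Real.pi * C₂) := by
    rw [ENNReal.ofReal_mul Real.pi_pos.le]
    refine (lintegral_potential_le hgm hker).trans ?_
    gcongr
  rw [nlint]
  calc ENNReal.ofReal (1 / Real.pi) * ∫⁻ z in uDisc,
        ENNReal.ofReal (‖f z‖ ^ (2 * ρ) * ‖deriv (outerPart f Γ) z‖ ^ 2)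
      ≤ ENNReal.ofReal (1 / Real.pi) * ∫⁻ z in uDisc, (ENNReal.ofReal 2 * g z +
          ENNReal.ofReal (8 * C₁) * (1 + ENNReal.ofReal (10 ^ s) * P z)) := by
        exact mul_le_mul' le_rfl (setLIntegral_mono' measurableSet_ball hbound)
    _ = ENNReal.ofReal (1 / Real.pi) * (ENNReal.ofReal 2 * (∫⁻ z in uDisc, g z) +
          ENNReal.ofReal (8 * C₁) *
            (ENNReal.ofReal Real.pi + ENNReal.ofReal (10 ^ s) * ∫⁻ z in uDisc, P z)) := by
        rw [lintegral_add_left (by fun_prop), lintegral_const_mul' _ _ ENNReal.ofReal_ne_top,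
          lintegral_const_mul' _ _ ENNReal.ofReal_ne_top, lintegral_add_left (by fun_prop),
          lintegral_const_mul' _ _ ENNReal.ofReal_ne_top, setLIntegral_const, one_mul, hvol]
    _ ≤ ENNReal.ofReal (1 / Real.pi) * (ENNReal.ofReal 2 * ENNReal.ofReal Real.pi +
          ENNReal.ofReal (8 * C₁) *
            (ENNReal.ofReal Real.pi + ENNReal.ofReal (10 ^ s) * ENNReal.ofReal (Real.pi * C₂))) := by
        gcongr
    _ = ENNReal.ofReal (2 + 8 * C₁ * (1 + 10 ^ s * C₂)) := by
        rw [← ENNReal.ofReal_mul (by positivity), ← ENNReal.ofReal_mul (by positivity),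
          ← ENNReal.ofReal_add (by positivity) (by positivity),
          ← ENNReal.ofReal_mul (by positivity), ← ENNReal.ofReal_add (by positivity)
          (by positivity), ← ENNReal.ofReal_mul (by positivity)]
        congr 1
        field_simp
end

section
/- Let 0 < α ≤ 1 and let f be analytic on 𝔻, continuous on the closed disc, with |f(z)−f(w)| = o(|z−w|^α) as |z−w| → 0 and f ≢ 0. Let E_f := {ξ ∈ 𝕋 : f(ξ) = 0}. Then E_f satisfies the Carleson condition: ∫_0^{2π} log(1/d(e^{it}, E_f)) dt < +∞, where d(ξ, E_f) is the distance from ξ to E_f. -/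
open Complex MeasureTheory Set Metric Filter
open scoped ENNReal Classical

/-- By Jensen's formula, the circle averages of `log ‖f‖` over circles of radius close to `1` are
bounded below. -/
theorem exists_le_circleAverage_log_norm {f : ℂ → ℂ} (hf : DifferentiableOn ℂ f (ball 0 1)) :
    ∃ B : ℝ, ∀ R ∈ Ico (1 / 2 : ℝ) 1, B ≤ Real.circleAverage (Real.log ‖f ·‖) 0 R := by
  have han : AnalyticOnNhd ℂ f (ball 0 1) := hf.analyticOnNhd isOpen_ball
  refine ⟨((meromorphicOrderAt f 0).untop₀ : ℝ) * Real.log (1 / 2) +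
    Real.log ‖meromorphicTrailingCoeffAt f 0‖, fun R hR ↦ ?_⟩
  have hR0 : 0 < R := lt_of_lt_of_le (by norm_num) hR.1
  have hanR : AnalyticOnNhd ℂ f (closedBall 0 |R|) :=
    han.mono (closedBall_subset_ball (by rw [abs_of_pos hR0]; exact hR.2))
  have hnonneg := MeromorphicOn.AnalyticOnNhd.divisor_nonneg hanR
  have hzero : MeromorphicOn.divisor f (closedBall 0 |R|) 0 = (meromorphicOrderAt f 0).untop₀ :=
    MeromorphicOn.divisor_apply hanR.meromorphicOn (by simp)
  have hord : (0 : ℝ) ≤ ((meromorphicOrderAt f 0).untop₀ : ℝ) := by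
    rw [← hzero]; exact_mod_cast hnonneg 0
  rw [MeromorphicOn.circleAverage_log_norm hR0.ne' hanR.meromorphicOn, hzero]
  have hsum : 0 ≤ ∑ᶠ u, (MeromorphicOn.divisor f (closedBall 0 |R|) u : ℝ) *
      Real.log (R * ‖0 - u‖⁻¹) := by
    refine finsum_nonneg fun u ↦ ?_
    by_cases hu : u ∈ closedBall (0 : ℂ) |R|
    · refine mul_nonneg (by exact_mod_cast hnonneg u) ?_
      rcases eq_or_ne u 0 with rfl | hu0
      · simp
      · refine Real.log_nonneg ?_
        have hpos : 0 < ‖u‖ := norm_pos_iff.mpr hu0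
        rw [zero_sub, norm_neg, ← div_eq_mul_inv, one_le_div hpos]
        simpa [abs_of_pos hR0] using hu
    · simp [hu]
  have hlog : Real.log (1 / 2) ≤ Real.log R := Real.log_le_log (by norm_num) hR.1
  nlinarith [mul_le_mul_of_nonneg_left hlog hord]

/-- The negative parts of `log ‖f‖` have uniformly bounded integrals over circles of radius close
to `1`, for `f` bounded and analytic in the unit disc. -/
theorem exists_lintegral_neg_log_norm_circleMap_le {f : ℂ → ℂ} {M : ℝ}
    (hf : DifferentiableOn ℂ f (ball 0 1)) (hM : 1 ≤ M) (hbd : ∀ z ∈ ball (0 : ℂ) 1, ‖f z‖ ≤ M) :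
    ∃ C : ℝ, ∀ R ∈ Ico (1 / 2 : ℝ) 1,
      ∫⁻ t in Ioc (0 : ℝ) (2 * Real.pi), ENNReal.ofReal (-Real.log ‖f (circleMap 0 R t)‖)
        ≤ ENNReal.ofReal C := by
  obtain ⟨B, hB⟩ := exists_le_circleAverage_log_norm hf
  refine ⟨2 * Real.pi * (Real.log M - B), fun R hR ↦ ?_⟩
  have hR0 : 0 < R := lt_of_lt_of_le (by norm_num) hR.1
  have hmem : ∀ t, circleMap 0 R t ∈ ball (0 : ℂ) 1 := fun t ↦ by
    simpa [abs_of_pos hR0] using hR.2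
  have hint : IntervalIntegrable (fun t ↦ Real.log ‖f (circleMap 0 R t)‖) volume 0
      (2 * Real.pi) := by
    refine MeromorphicOn.circleIntegrable_log_norm (f := f) (c := 0) (R := R)
      ((hf.analyticOnNhd isOpen_ball).mono ?_).meromorphicOn
    exact sphere_subset_closedBall.trans
      (closedBall_subset_ball (by rw [abs_of_pos hR0]; exact hR.2))
  have hlogM : 0 ≤ Real.log M := Real.log_nonneg hM
  have hle : ∀ t, Real.log ‖f (circleMap 0 R t)‖ ≤ Real.log M := fun t ↦ by
    rcases (norm_nonneg (f (circleMap 0 R t))).eq_or_lt with h | h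
    · rw [← h, Real.log_zero]; exact hlogM
    · exact Real.log_le_log h (hbd _ (hmem t))
  have havg : 2 * Real.pi * Real.circleAverage (Real.log ‖f ·‖) 0 R =
      ∫ t in (0 : ℝ)..(2 * Real.pi), Real.log ‖f (circleMap 0 R t)‖ := by
    rw [Real.circleAverage_def, smul_eq_mul, mul_inv_cancel_left₀ Real.two_pi_pos.ne']
  calc ∫⁻ t in Ioc (0 : ℝ) (2 * Real.pi), ENNReal.ofReal (-Real.log ‖f (circleMap 0 R t)‖)
      ≤ ∫⁻ t in Ioc (0 : ℝ) (2 * Real.pi),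
          ENNReal.ofReal (Real.log M - Real.log ‖f (circleMap 0 R t)‖) :=
        lintegral_mono fun t ↦ ENNReal.ofReal_le_ofReal (by linarith)
    _ = ENNReal.ofReal (∫ t in (0 : ℝ)..(2 * Real.pi),
          (Real.log M - Real.log ‖f (circleMap 0 R t)‖)) := by
        rw [intervalIntegral.integral_of_le Real.two_pi_pos.le,
          ofReal_integral_eq_lintegral_ofReal]
        · exact (intervalIntegrable_const.sub hint).1
        · exact Eventually.of_forall fun t ↦ sub_nonneg.mpr (hle t)
    _ ≤ ENNReal.ofReal (2 * Real.pi * (Real.log M - B)) := by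
        refine ENNReal.ofReal_le_ofReal ?_
        rw [intervalIntegral.integral_sub intervalIntegrable_const hint, ← havg,
          intervalIntegral.integral_const, smul_eq_mul, sub_zero, ← mul_sub]
        exact mul_le_mul_of_nonneg_left (by linarith [hB R hR]) Real.two_pi_pos.le

/-- The negative part of `log ‖f‖` is integrable over the unit circle, for `f` in the disc
algebra. -/
theorem lintegral_neg_log_norm_lt_top {f : ℂ → ℂ} (hf : IsDiscReg f) :
    ∫⁻ t in Ioc (0 : ℝ) (2 * Real.pi), ENNReal.ofReal (-Real.log ‖f (circleMap 0 1 t)‖) < ⊤ := by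
  obtain ⟨M, hM⟩ := (isCompact_closedBall (0 : ℂ) 1).exists_bound_of_continuousOn hf.2
  obtain ⟨C, hC⟩ := exists_lintegral_neg_log_norm_circleMap_le (M := max 1 M) hf.1
    (le_max_left _ _) fun z hz ↦ (hM z (ball_subset_closedBall hz)).trans (le_max_right _ _)
  obtain ⟨r, -, hr, hrlim⟩ := exists_seq_strictMono_tendsto' (show (1 / 2 : ℝ) < 1 by norm_num)
  have hr0 : ∀ n, 0 < r n := fun n ↦ lt_trans (by norm_num) (hr n).1
  have hmem : ∀ n t, circleMap 0 (r n) t ∈ closedBall (0 : ℂ) 1 := fun n t ↦ by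
    simpa [abs_of_pos (hr0 n)] using (hr n).2.le
  have hmeas : ∀ n, Measurable fun t ↦ ENNReal.ofReal (-Real.log ‖f (circleMap 0 (r n) t)‖) := by
    intro n
    have : Continuous fun t ↦ f (circleMap 0 (r n) t) :=
      hf.2.comp_continuous (continuous_circleMap 0 _) (hmem n)
    exact (Real.measurable_log.comp this.norm.measurable).neg.ennreal_ofReal
  have hlim : ∀ t, ENNReal.ofReal (-Real.log ‖f (circleMap 0 1 t)‖) ≤
      liminf (fun n ↦ ENNReal.ofReal (-Real.log ‖f (circleMap 0 (r n) t)‖)) atTop := by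
    intro t
    by_cases h0 : f (circleMap 0 1 t) = 0
    · simp [h0]
    have hcm : Tendsto (fun n ↦ circleMap 0 (r n) t) atTop (nhds (circleMap 0 1 t)) := by
      have hcont : Continuous fun R : ℝ ↦ circleMap 0 R t := by unfold circleMap; fun_prop
      exact (hcont.tendsto 1).comp hrlim
    have hft : Tendsto (fun n ↦ f (circleMap 0 (r n) t)) atTop (nhds (f (circleMap 0 1 t))) :=
      (hf.2 (circleMap 0 1 t) (by simp)).tendsto.comp
        (tendsto_nhdsWithin_iff.mpr ⟨hcm, Eventually.of_forall fun n ↦ hmem n t⟩)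
    exact (ENNReal.tendsto_ofReal
      (hft.norm.log (norm_ne_zero_iff.mpr h0)).neg).liminf_eq.ge
  calc _ ≤ ∫⁻ t in Ioc (0 : ℝ) (2 * Real.pi),
        liminf (fun n ↦ ENNReal.ofReal (-Real.log ‖f (circleMap 0 (r n) t)‖)) atTop :=
        lintegral_mono hlim
    _ ≤ liminf (fun n ↦ ∫⁻ t in Ioc (0 : ℝ) (2 * Real.pi),
          ENNReal.ofReal (-Real.log ‖f (circleMap 0 (r n) t)‖)) atTop := lintegral_liminf_le hmeas
    _ ≤ ENNReal.ofReal C := liminf_le_of_le (by isBoundedDefault) fun b hb ↦ by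
        obtain ⟨n, hn⟩ := hb.exists
        exact hn.trans (hC _ ⟨(hr n).1.le, (hr n).2⟩)
    _ < ⊤ := ENNReal.ofReal_lt_top

/-- Near its boundary zero set a function of `lip_α` is dominated by the `α`-th power of the
distance, so `log (1 / d(ξ, E_f))` is controlled by `-log |f ξ|`. -/
theorem LittleLip.exists_log_infDist_le {α : ℝ} (hα : 0 < α) {f : ℂ → ℂ} (hf : IsDiscReg f)
    (hlip : LittleLip α f) : ∃ δ : ℝ, ∀ ξ ∈ uCircle,
      ENNReal.ofReal (Real.log (1 / infDist ξ (bZeros f))) ≤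
        ENNReal.ofReal (-Real.log δ) +
          ENNReal.ofReal α⁻¹ * ENNReal.ofReal (-Real.log ‖f ξ‖) := by
  obtain ⟨δ, hδ, h⟩ := hlip 1 one_pos
  refine ⟨δ, fun ξ hξ ↦ ?_⟩
  rw [one_div, Real.log_inv]
  rcases (bZeros f).eq_empty_or_nonempty with hE | hE
  · simp [hE]
  have hsub : uCircle ⊆ closedBall (0 : ℂ) 1 := sphere_subset_closedBall
  have hcl : IsClosed (bZeros f) :=
    (hf.2.mono hsub).preimage_isClosed_of_isClosed isClosed_sphere isClosed_singleton
  obtain ⟨η, hη, hd⟩ := hcl.exists_infDist_eq_dist hE ξ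
  rw [hd, dist_eq_norm]
  rcases lt_or_ge ‖ξ - η‖ δ with hlt | hge
  · refine le_add_left ?_
    rw [← ENNReal.ofReal_mul (inv_nonneg.mpr hα.le)]
    by_cases h0 : f ξ = 0
    · have hzero : infDist ξ (bZeros f) = 0 := infDist_zero_of_mem ⟨hξ, h0⟩
      rw [hd, dist_eq_norm] at hzero
      simp [hzero]
    · have hfξ : ‖f ξ‖ ≤ ‖ξ - η‖ ^ α := by
        simpa [hη.2] using h ξ (hsub hξ) η (hsub hη.1) hlt
      have hpos : 0 < ‖ξ - η‖ := norm_pos_iff.mpr fun he ↦ h0 (sub_eq_zero.mp he ▸ hη.2)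
      have hlog := Real.log_le_log (norm_pos_iff.mpr h0) hfξ
      rw [Real.log_rpow hpos] at hlog
      refine ENNReal.ofReal_le_ofReal ?_
      rw [inv_mul_eq_div, le_div_iff₀ hα]
      linarith
  · exact le_add_right (ENNReal.ofReal_le_ofReal (neg_le_neg (Real.log_le_log hδ hge)))

/-- For `f ∈ lip_α`, `f ≢ 0`, the boundary zero set `E_f` satisfies
the Carleson condition `∫_𝕋 log(1/d(e^{it}, E_f)) dt < +∞`. -/
theorem carleson_condition (α : ℝ) (hα0 : 0 < α) (hα1 : α ≤ 1)
    (f : ℂ → ℂ) (hf : IsDiscReg f) (hlip : LittleLip α f)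
    (hne : ∃ z ∈ Metric.closedBall (0:ℂ) 1, f z ≠ 0) :
    (∫⁻ t in Set.Ioc (0 : ℝ) (2 * Real.pi),
      ENNReal.ofReal (Real.log
        (1 / Metric.infDist (Complex.exp ((t : ℂ) * Complex.I)) (bZeros f)))) < ⊤ := by
  obtain ⟨δ, hδ⟩ := hlip.exists_log_infDist_le hα0 hf
  calc _ ≤ ∫⁻ t in Ioc (0 : ℝ) (2 * Real.pi), (ENNReal.ofReal (-Real.log δ) +
        ENNReal.ofReal α⁻¹ * ENNReal.ofReal (-Real.log ‖f (circleMap 0 1 t)‖)) :=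
        lintegral_mono fun t ↦ by
          have ht := hδ (circleMap 0 1 t) (circleMap_mem_sphere 0 zero_le_one t)
          simpa only [circleMap, ofReal_one, one_mul, zero_add] using ht
    _ < ⊤ := by
        rw [lintegral_add_left measurable_const, lintegral_const_mul' _ _ ENNReal.ofReal_ne_top,
          lintegral_const]
        exact ENNReal.add_lt_top.mpr
          ⟨ENNReal.mul_lt_top ENNReal.ofReal_lt_top (measure_lt_top _ _),
            ENNReal.mul_lt_top ENNReal.ofReal_lt_top (lintegral_neg_log_norm_lt_top hf)⟩
end
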